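/- arXiv:1906.03668 — 4 statements merged into one kernel-verified Lean document; each statement's English description precedes it below -/
import Mathlib

section
/- Let k be a natural number and let c : ℕ × ℕ → ℝ be coefficients with c(a,b) = 0 whenever a + b > k. Define f : ℝ² → ℝ by f(x,y) = Σ_{a+b ≤ k} c(a,b) · exp(−(x²+y²)/2) · H_a(x) · H_b(y), where H_j denotes the j-th Hermite polynomial. If f is not identically zero, then the number of connected components of the set {(x,y) ∈ ℝ² | f(x,y) ≠ 0} is at most k(k+1)/2 + 1. (These functions f are exactly the linear combinations of the eigenfunctions of the isotropic quantum harmonic oscillator −Δ + x² + y² with eigenvalue at most 2(k+1); hence the Extended Courant property holds for this operator.) -/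
open Real

namespace NodalCount

open Polynomial Set

/-- A family of univariate polynomials of degree at most `k`, whose roots are locally uniformly
bounded and whose derivatives depend continuously on the parameter. -/
structure SliceFamily (q : ℝ → ℝ[X]) (k : ℕ) : Prop where
  natDegree_le : ∀ x, (q x).natDegree ≤ k
  ne_zero : ∀ x, q x ≠ 0
  continuous_eval : ∀ m, Continuous fun z : ℝ × ℝ => (derivative^[m] (q z.1)).eval z.2
  bound : ∀ a : ℝ, ∃ δ > 0, ∃ B : ℝ, ∀ x y, |x - a| < δ → B ≤ |y| → (q x).eval y ≠ 0

/-- The part of the complement of the zero set lying over `I`. -/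
def region (q : ℝ → ℝ[X]) (I : Set ℝ) : Set (ℝ × ℝ) :=
  {z | z.1 ∈ I ∧ (q z.1).eval z.2 ≠ 0}

section Components

variable {q : ℝ → ℝ[X]} {k : ℕ}

theorem SliceFamily.continuous (hq : SliceFamily q k) :
    Continuous fun z : ℝ × ℝ => (q z.1).eval z.2 := hq.continuous_eval 0

theorem SliceFamily.isOpen_region (hq : SliceFamily q k) {I : Set ℝ} (hI : IsOpen I) :
    IsOpen (region q I) :=
  (hI.preimage continuous_fst).inter (isOpen_ne_fun hq.continuous continuous_const)

theorem subset_component {X : Type*} [TopologicalSpace X] {F S : Set X} {s t : X}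
    (hS : IsPreconnected S) (hSF : S ⊆ F) (hs : s ∈ S) (hst : s ∈ connectedComponentIn F t) :
    S ⊆ connectedComponentIn F t := by
  rw [connectedComponentIn_eq hst]
  exact hS.subset_connectedComponentIn hs hSF

theorem mem_component_of_mem_closure {X : Type*} [TopologicalSpace X] [LocallyConnectedSpace X]
    {F : Set X} (hF : IsOpen F) {z t : X} (hz : z ∈ closure (connectedComponentIn F t))
    (hzF : z ∈ F) : z ∈ connectedComponentIn F t := by
  obtain ⟨w, hw, hw'⟩ := mem_closure_iff.1 hz _ (hF.connectedComponentIn (x := z))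
    (mem_connectedComponentIn hzF)
  rw [connectedComponentIn_eq hw', ← connectedComponentIn_eq hw]
  exact mem_connectedComponentIn hzF

theorem horizontal_mem {I : Set ℝ} {t : ℝ × ℝ} {x x' y : ℝ}
    (h : ∀ s ∈ uIcc x x', s ∈ I ∧ (q s).eval y ≠ 0)
    (hx : (x, y) ∈ connectedComponentIn (region q I) t) :
    (x', y) ∈ connectedComponentIn (region q I) t := by
  refine subset_component (S := uIcc x x' ×ˢ {y}) (s := (x, y))
    (isPreconnected_uIcc.prod isPreconnected_singleton) ?_ (by simp) hx (by simp)
  rintro ⟨s, y'⟩ ⟨hs, rfl⟩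
  exact h s hs

theorem vertical_mem {I : Set ℝ} {t : ℝ × ℝ} {x y y' : ℝ}
    (h : ∀ s ∈ uIcc y y', (q x).eval s ≠ 0)
    (hx : (x, y) ∈ connectedComponentIn (region q I) t) :
    (x, y') ∈ connectedComponentIn (region q I) t := by
  have hxI : x ∈ I := (connectedComponentIn_subset _ _ hx).1
  refine subset_component (S := {x} ×ˢ uIcc y y') (s := (x, y))
    (isPreconnected_singleton.prod isPreconnected_uIcc) ?_ (by simp) hx (by simp)
  rintro ⟨s, y'⟩ ⟨rfl, hs⟩
  exact ⟨hxI, h _ hs⟩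

/-- Rolle's theorem for several roots in an interval. -/
theorem card_roots_le_of_iterate_derivative (m : ℕ) (p : ℝ[X]) {a b : ℝ}
    (h : ∀ y ∈ Icc a b, (derivative^[m] p).eval y ≠ 0) (s : Finset ℝ)
    (hs : ∀ y ∈ s, y ∈ Icc a b ∧ p.eval y = 0) : s.card ≤ m := by
  induction m generalizing p s with
  | zero =>
    simp only [nonpos_iff_eq_zero, Finset.card_eq_zero]
    by_contra hne
    obtain ⟨y, hy⟩ := Finset.nonempty_iff_ne_empty.2 hne
    exact h y (hs y hy).1 (hs y hy).2
  | succ m ih =>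
    have hne : derivative p ≠ 0 ∨ s = ∅ := by
      by_contra hcon
      push Not at hcon
      obtain ⟨y, hy⟩ := hcon.2
      apply h y (hs y hy).1
      simp [Function.iterate_succ_apply, hcon.1]
    rcases hne with hne | rfl
    swap
    · simp
    classical
    let t := (derivative p).roots.toFinset.filter (fun y => y ∈ Icc a b)
    have ht : t.card ≤ m := by
      refine ih (derivative p) (fun y hy => ?_) t (fun y hy => ?_)
      · simpa [Function.iterate_succ_apply] using h y hy
      · simp only [t, Finset.mem_filter, Multiset.mem_toFinset, mem_roots hne] at hy
        exact ⟨hy.2, hy.1⟩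
    refine (Finset.card_le_of_interleaved (t := t) ?_).trans (Nat.succ_le_succ ht)
    intro x hx y hy hxy _
    obtain ⟨c, hc, hc'⟩ := exists_deriv_eq_zero (f := fun y => p.eval y) hxy
      p.continuous.continuousOn ((hs x hx).2.trans (hs y hy).2.symm)
    refine ⟨c, ?_, hc.1, hc.2⟩
    simp only [t, Finset.mem_filter, Multiset.mem_toFinset, mem_roots hne]
    refine ⟨?_, (hs x hx).1.1.trans hc.1.le, hc.2.le.trans (hs y hy).1.2⟩
    simpa [IsRoot, Polynomial.deriv] using hc'

/-- Small boxes around a zero of finite order on a vertical line. -/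
theorem SliceFamily.exists_box (hq : SliceFamily q k) {I : Set ℝ} (hI : IsOpen I) {a y₀ : ℝ}
    (ha : a ∈ I) {m : ℕ} (hm : (derivative^[m] (q a)).eval y₀ ≠ 0) :
    ∃ δ > 0, ∃ η > 0, Ioo (a - δ) (a + δ) ⊆ I ∧
      (∀ x ∈ Ioo (a - δ) (a + δ), (q x).eval (y₀ - η) ≠ 0 ∧ (q x).eval (y₀ + η) ≠ 0) ∧
      ∀ x ∈ Ioo (a - δ) (a + δ), ∀ s : Finset ℝ,
        (∀ y ∈ s, y ∈ Icc (y₀ - η) (y₀ + η) ∧ (q x).eval y = 0) → s.card ≤ m := by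
  have hev : ∀ᶠ z : ℝ × ℝ in nhds (a, y₀), z.1 ∈ I ∧ (derivative^[m] (q z.1)).eval z.2 ≠ 0 :=
    Filter.Eventually.and ((hI.preimage continuous_fst).mem_nhds (x := (a, y₀)) ha)
      ((hq.continuous_eval m).continuousAt.eventually_ne hm)
  obtain ⟨ε, hε, hball⟩ := Metric.eventually_nhds_iff.1 hev
  have hbox : ∀ x y, |x - a| < ε → |y - y₀| < ε →
      x ∈ I ∧ (derivative^[m] (q x)).eval y ≠ 0 := fun x y hx hy =>
    @hball (x, y) (by rw [Prod.dist_eq]; exact max_lt hx hy)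
  have hroot : ∃ η, 0 < η ∧ η < ε ∧ (q a).eval (y₀ - η) ≠ 0 ∧ (q a).eval (y₀ + η) ≠ 0 := by
    have hfin : ({η | (q a).eval (y₀ - η) = 0} ∪ {η | (q a).eval (y₀ + η) = 0}).Finite := by
      refine Finite.union ?_ ?_
      · refine (((q a).roots.toFinset.finite_toSet).image (fun y => y₀ - y)).subset ?_
        intro η hη
        exact ⟨y₀ - η, by simpa [hq.ne_zero a] using hη, by simp⟩
      · refine (((q a).roots.toFinset.finite_toSet).image (fun y => y - y₀)).subset ?_
        intro η hη
        exact ⟨y₀ + η, by simpa [hq.ne_zero a] using hη, by simp⟩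
    obtain ⟨η, hη, hη'⟩ := ((Ioo_infinite hε).sdiff hfin).nonempty
    simp only [mem_union, mem_ofPred_eq, not_or] at hη'
    exact ⟨η, hη.1, hη.2, hη'⟩
  obtain ⟨η, hη0, hηε, h1, h2⟩ := hroot
  have hc : ∀ y, Continuous fun x => (q x).eval y := fun y =>
    hq.continuous.comp (by fun_prop : Continuous fun x : ℝ => (x, y))
  have hev2 := (((hc (y₀ - η)).continuousAt (x := a)).eventually_ne h1).and
    (((hc (y₀ + η)).continuousAt (x := a)).eventually_ne h2)
  obtain ⟨δ, hδ, hδ'⟩ := Metric.eventually_nhds_iff.1 hev2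
  have habs : ∀ x ∈ Ioo (a - min δ ε) (a + min δ ε), |x - a| < δ ∧ |x - a| < ε := by
    intro x hx
    have : |x - a| < min δ ε := abs_lt.2 ⟨by linarith [hx.1], by linarith [hx.2]⟩
    exact lt_min_iff.1 this
  refine ⟨min δ ε, lt_min hδ hε, η, hη0, fun x hx => (hbox x y₀ (habs x hx).2 (by simpa)).1,
    fun x hx => hδ' (habs x hx).1, fun x hx s hs => ?_⟩
  refine card_roots_le_of_iterate_derivative m (q x) (fun y hy => ?_) s hs
  refine (hbox x y (habs x hx).2 (abs_lt.2 ⟨?_, ?_⟩)).2 <;> linarith [hy.1, hy.2]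

/-- Components lying to the right of `a` and crossing a small box on a common vertical line. -/
theorem card_succ_le_of_box {I : Set ℝ} {a y₀ δ η : ℝ} {m : ℕ} (hq : SliceFamily q k)
    (hη : 0 < η) (hI : Ioo (a - δ) (a + δ) ⊆ I)
    (hedge : ∀ x ∈ Ioo (a - δ) (a + δ), (q x).eval (y₀ - η) ≠ 0 ∧ (q x).eval (y₀ + η) ≠ 0)
    {x : ℝ} (hx : x ∈ Ioo (a - δ) (a + δ)) (hax : a < x)
    (hcard : ∀ s : Finset ℝ,
      (∀ y ∈ s, y ∈ Icc (y₀ - η) (y₀ + η) ∧ (q x).eval y = 0) → s.card ≤ m)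
    (T : Finset (ℝ × ℝ)) (hT : T.Nonempty)
    (hdisj : ∀ t ∈ T, ∀ t' ∈ T, ∀ u, u ∈ connectedComponentIn (region q I) t →
      u ∈ connectedComponentIn (region q I) t' → t = t')
    (hright : ∀ t ∈ T, ∀ u ∈ connectedComponentIn (region q I) t, a ≤ u.1)
    (y : ℝ × ℝ → ℝ) (hy : ∀ t ∈ T, y t ∈ Ioo (y₀ - η) (y₀ + η))
    (hmem : ∀ t ∈ T, (x, y t) ∈ connectedComponentIn (region q I) t) : T.card + 1 ≤ m := by
  classical
  have hslide : ∀ t ∈ T, ∀ y', (y' = y₀ - η ∨ y' = y₀ + η) →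
      (x, y') ∉ connectedComponentIn (region q I) t := by
    intro t ht y' hy' hcon
    have : ((a - δ + a) / 2, y') ∈ connectedComponentIn (region q I) t := by
      refine horizontal_mem (fun s hs => ?_) hcon
      rw [uIcc_of_ge (by linarith [hx.1, hx.2])] at hs
      have hs' : s ∈ Ioo (a - δ) (a + δ) := ⟨by linarith [hs.1, hx.1, hx.2], by linarith [hs.2, hx.2]⟩
      refine ⟨hI hs', ?_⟩
      rcases hy' with rfl | rfl
      · exact (hedge s hs').1
      · exact (hedge s hs').2
    have := hright t ht _ this
    simp only at this
    linarith [hx.1, hx.2]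
  have hinj : Set.InjOn y T := by
    intro t ht t' ht' h
    exact hdisj t ht t' ht' (x, y t) (hmem t ht) (h ▸ hmem t' ht')
  set Y : Finset ℝ := insert (y₀ - η) (insert (y₀ + η) (T.image y)) with hY
  have hYcard : Y.card = T.card + 2 := by
    rw [hY, Finset.card_insert_of_notMem, Finset.card_insert_of_notMem,
      Finset.card_image_of_injOn hinj]
    · simp only [Finset.mem_image, not_exists, not_and]
      exact fun t ht => (hy t ht).2.ne
    · simp only [Finset.mem_insert, Finset.mem_image, not_or, not_exists, not_and]
      exact ⟨by linarith, fun t ht => (hy t ht).1.ne'⟩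
  let R := (q x).roots.toFinset.filter (fun y => y ∈ Icc (y₀ - η) (y₀ + η))
  have hR : ∀ r, r ∈ R ↔ (q x).eval r = 0 ∧ r ∈ Icc (y₀ - η) (y₀ + η) := by
    intro r
    simp [R, hq.ne_zero x]
  have hRm : R.card ≤ m := hcard R fun r hr => ((hR r).1 hr).symm
  have hYR : Y.card ≤ R.card + 1 := by
    refine Finset.card_le_of_interleaved ?_
    have hYmem : ∀ r, r ∈ Y ↔ r = y₀ - η ∨ r = y₀ + η ∨ ∃ t ∈ T, y t = r := by
      intro r; simp [hY]
    have hYI : ∀ r ∈ Y, r ∈ Icc (y₀ - η) (y₀ + η) := by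
      intro r hr
      rcases (hYmem r).1 hr with rfl | rfl | ⟨t, ht, rfl⟩
      · exact ⟨le_rfl, by linarith⟩
      · exact ⟨by linarith, le_rfl⟩
      · exact Ioo_subset_Icc_self (hy t ht)
    have hYne : ∀ r ∈ Y, (q x).eval r ≠ 0 := by
      intro r hr
      rcases (hYmem r).1 hr with rfl | rfl | ⟨t, ht, rfl⟩
      · exact (hedge x hx).1
      · exact (hedge x hx).2
      · exact (connectedComponentIn_subset _ _ (hmem t ht)).2
    intro r hr r' hr' hlt hcons
    by_contra hno
    push Not at hno
    have hseg : ∀ s ∈ Icc r r', (q x).eval s ≠ 0 := by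
      intro s hs h0
      rcases eq_or_lt_of_le hs.1 with rfl | h1
      · exact hYne _ hr h0
      rcases eq_or_lt_of_le hs.2 with rfl | h2
      · exact hYne _ hr' h0
      have := hno s ((hR s).2 ⟨h0, (hYI r hr).1.trans hs.1, hs.2.trans (hYI r' hr').2⟩) h1
      linarith
    have key : ∀ t ∈ T, (x, r) ∈ connectedComponentIn (region q I) t ↔
        (x, r') ∈ connectedComponentIn (region q I) t := by
      intro t _
      constructor <;> refine fun h => vertical_mem (fun s hs => hseg s ?_) h
      · rwa [uIcc_of_le hlt.le] at hs
      · rwa [uIcc_of_ge hlt.le] at hs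
    rcases (hYmem r).1 hr with h | h | ⟨t, ht, h⟩
    · rcases (hYmem r').1 hr' with h' | h' | ⟨t', ht', h'⟩
      · linarith
      · obtain ⟨t, ht⟩ := hT
        refine hcons (y t) ((hYmem _).2 (Or.inr (Or.inr ⟨t, ht, rfl⟩))) ?_
        rw [h, h']
        exact hy t ht
      · exact hslide t' ht' r (Or.inl h) ((key t' ht').2 (h' ▸ hmem t' ht'))
    · rcases (hYmem r').1 hr' with h' | h' | ⟨t', ht', h'⟩
      · linarith
      · linarith
      · linarith [(hy t' ht').2]
    · have h1 : (x, r') ∈ connectedComponentIn (region q I) t := (key t ht).1 (h ▸ hmem t ht)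
      rcases (hYmem r').1 hr' with h' | h' | ⟨t', ht', h'⟩
      · exact hslide t ht r' (Or.inl h') h1
      · exact hslide t ht r' (Or.inr h') h1
      · have := hdisj t ht t' ht' _ h1 (h' ▸ hmem t' ht')
        subst this
        linarith
  omega

end Components

section Births

variable {q : ℝ → ℝ[X]} {k : ℕ}

theorem lt_fst_of_component {I : Set ℝ} (hq : SliceFamily q k) (hI : IsOpen I) {a : ℝ}
    {t : ℝ × ℝ} (hle : ∀ u ∈ connectedComponentIn (region q I) t, a ≤ u.1) :
    ∀ u ∈ connectedComponentIn (region q I) t, a < u.1 := by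
  intro u hu
  refine lt_of_le_of_ne (hle u hu) fun h => ?_
  have hopen := (hq.isOpen_region hI).connectedComponentIn (x := t)
  obtain ⟨ε, hε, hball⟩ := Metric.isOpen_iff.1 hopen u hu
  have : (u.1 - ε / 2, u.2) ∈ connectedComponentIn (region q I) t := by
    apply hball
    rw [Metric.mem_ball, Prod.dist_eq]
    refine max_lt ?_ (by simpa using hε)
    rw [Real.dist_eq, show u.1 - ε / 2 - u.1 = -(ε / 2) by ring, abs_neg, abs_of_pos (by linarith)]
    linarith
  have := hle _ this
  simp only at this
  linarith

/-- A component bounded on the left has a leftmost boundary point, which is a critical point of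
the slice through it. -/
theorem SliceFamily.exists_leftmost (hq : SliceFamily q k) {I : Set ℝ} (hI : IsOpen I) {a : ℝ}
    (ha : a ∈ I) {t : ℝ × ℝ}
    (hle : ∀ u ∈ connectedComponentIn (region q I) t, a ≤ u.1)
    (hnear : ∀ ε > 0, ∃ u ∈ connectedComponentIn (region q I) t, u.1 < a + ε) :
    ∃ y₀, (a, y₀) ∈ closure (connectedComponentIn (region q I) t) ∧
      (q a).eval y₀ = 0 ∧ (derivative (q a)).eval y₀ = 0 := by
  set U := connectedComponentIn (region q I) t with hU
  have hlt := lt_fst_of_component hq hI hle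
  obtain ⟨δ₀, hδ₀, hδI⟩ := Metric.isOpen_iff.1 hI a ha
  obtain ⟨δ₁, hδ₁, B, hB⟩ := hq.bound a
  obtain ⟨δ, hδ, hδ0, hδ1⟩ : ∃ δ > 0, δ < δ₀ ∧ δ < δ₁ :=
    ⟨min δ₀ δ₁ / 2, by positivity, by
      have := min_le_left δ₀ δ₁; have : 0 < min δ₀ δ₁ := lt_min hδ₀ hδ₁; linarith, by
      have := min_le_right δ₀ δ₁; have : 0 < min δ₀ δ₁ := lt_min hδ₀ hδ₁; linarith⟩
  have hbdd : ∀ u ∈ U, u.1 < a + δ → |u.2| < B := by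
    intro u hu hua
    by_contra hcon
    push Not at hcon
    have : (a - δ, u.2) ∈ U := by
      refine horizontal_mem (x := u.1) (fun s hs => ?_) hu
      rw [uIcc_of_ge (by linarith [hlt u hu])] at hs
      have habs : |s - a| ≤ δ := abs_le.2 ⟨by linarith [hs.1], by linarith [hs.2]⟩
      refine ⟨hδI ?_, hB _ _ (habs.trans_lt hδ1) hcon⟩
      rw [Metric.mem_ball, Real.dist_eq]
      exact habs.trans_lt hδ0
    have := hlt _ this
    simp only at this
    linarith
  have hcle : ∀ z ∈ closure U, a ≤ z.1 := fun z hz =>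
    closure_minimal (s := U) (t := {z | a ≤ z.1}) hle (isClosed_le continuous_const continuous_fst)
      hz
  let K := closure U ∩ (Icc a (a + δ / 2) ×ˢ Icc (-B) B)
  have hKc : IsCompact K := (isCompact_Icc.prod isCompact_Icc).inter_left isClosed_closure
  have hKmem : ∀ u ∈ U, u.1 < a + δ / 2 → u ∈ K := by
    intro u hu hua
    have := abs_lt.1 (hbdd u hu (by linarith))
    exact ⟨subset_closure hu, ⟨hle u hu, hua.le⟩, this.1.le, this.2.le⟩
  obtain ⟨u₀, hu₀, hu₀'⟩ := hnear (δ / 2) (by positivity)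
  obtain ⟨⟨a', y₀⟩, hzK, hmin⟩ := hKc.exists_isMinOn ⟨u₀, hKmem u₀ hu₀ hu₀'⟩
    continuous_fst.continuousOn
  have haa' : a' = a := by
    refine le_antisymm ?_ (hcle _ hzK.1)
    by_contra hcon
    push Not at hcon
    obtain ⟨u, hu, hua⟩ := hnear (min (a' - a) (δ / 2)) (by
      refine lt_min ?_ ?_ <;> linarith)
    have h1 := min_le_left (a' - a) (δ / 2)
    have h2 := min_le_right (a' - a) (δ / 2)
    have h3 : a' ≤ u.1 := hmin (hKmem u hu (by linarith))
    linarith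
  subst haa'
  have hcl : (a', y₀) ∈ closure U := hzK.1
  have h0 : (q a').eval y₀ = 0 := by
    by_contra hne
    have := mem_component_of_mem_closure (hq.isOpen_region hI) hcl ⟨ha, hne⟩
    exact lt_irrefl _ (hlt _ this)
  refine ⟨y₀, hcl, h0, ?_⟩
  by_contra hne
  obtain ⟨δ', hδ', η, hη, hsub, hedge, hcard⟩ := hq.exists_box hI ha (m := 1) (y₀ := y₀)
    (by simpa using hne)
  obtain ⟨u, hu, huU⟩ := mem_closure_iff.1 hcl
    (Ioo (a' - δ') (a' + δ') ×ˢ Ioo (y₀ - η) (y₀ + η)) (isOpen_Ioo.prod isOpen_Ioo)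
    ⟨⟨by linarith, by linarith⟩, by simpa using hη⟩
  have := card_succ_le_of_box hq hη hsub hedge hu.1 (hlt u huU) (hcard _ hu.1) {t}
    (by simp) (by simp) (by simpa using hle) (fun _ => u.2) (by simpa using hu.2)
    (by simpa using huU)
  simp at this

/-- Without critical points, a component over an interval reaches the left end. -/
theorem SliceFamily.exists_mem_of_noncritical (hq : SliceFamily q k) {c c' : ℝ}
    (hno : ∀ x ∈ Ioo c c', ∀ y, (q x).eval y = 0 → (derivative (q x)).eval y ≠ 0)
    {u : ℝ × ℝ} (hu : u ∈ region q (Ioo c c')) {x : ℝ} (hx : x ∈ Ioc c u.1) :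
    ∃ y, (x, y) ∈ connectedComponentIn (region q (Ioo c c')) u := by
  by_contra hcon
  push Not at hcon
  set W := connectedComponentIn (region q (Ioo c c')) u with hW
  have huW : u ∈ W := mem_connectedComponentIn hu
  have hgt : ∀ w ∈ W, x ≤ w.1 := by
    intro w hw
    by_contra hlt
    push Not at hlt
    obtain ⟨v, hv, hvx⟩ := (isPreconnected_connectedComponentIn (F := region q (Ioo c c'))
      (x := u)).intermediate_value hw huW continuous_fst.continuousOn ⟨hlt.le, hx.2⟩
    exact hcon v.2 (by rw [← hvx]; exact hv)
  have hbdd : BddBelow (Prod.fst '' W) := ⟨x, by rintro _ ⟨w, hw, rfl⟩; exact hgt w hw⟩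
  have hne : (Prod.fst '' W).Nonempty := ⟨_, u, huW, rfl⟩
  have hxa : x ≤ sInf (Prod.fst '' W) := le_csInf hne (by
    rintro _ ⟨w, hw, rfl⟩; exact hgt w hw)
  have hau : sInf (Prod.fst '' W) ≤ u.1 := csInf_le hbdd ⟨u, huW, rfl⟩
  have haI : sInf (Prod.fst '' W) ∈ Ioo c c' :=
    ⟨hx.1.trans_le hxa, hau.trans_lt hu.1.2⟩
  obtain ⟨y₀, -, h0, h1⟩ := hq.exists_leftmost isOpen_Ioo haI (t := u)
    (fun w hw => csInf_le hbdd ⟨w, hw, rfl⟩) (fun ε hε => by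
      obtain ⟨_, ⟨w, hw, rfl⟩, hlt⟩ := exists_lt_of_csInf_lt hne
        (show sInf (Prod.fst '' W) < sInf (Prod.fst '' W) + ε by linarith)
      exact ⟨w, hw, hlt⟩)
  exact hno _ haI y₀ h0 h1

/-- The number of components with leftmost point `(a, y₀)` is smaller than the order of the
slice there. -/
theorem SliceFamily.card_births_lt (hq : SliceFamily q k) {a y₀ : ℝ} {m : ℕ}
    (hm : (derivative^[m] (q a)).eval y₀ ≠ 0)
    (hfin : {z : ℝ × ℝ | (q z.1).eval z.2 = 0 ∧ (derivative (q z.1)).eval z.2 = 0}.Finite)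
    (T : Finset (ℝ × ℝ)) (hT : T.Nonempty)
    (hdisj : ∀ t ∈ T, ∀ t' ∈ T, ∀ u, u ∈ connectedComponentIn (region q univ) t →
      u ∈ connectedComponentIn (region q univ) t' → t = t')
    (hright : ∀ t ∈ T, ∀ u ∈ connectedComponentIn (region q univ) t, a ≤ u.1)
    (hcl : ∀ t ∈ T, (a, y₀) ∈ closure (connectedComponentIn (region q univ) t)) :
    T.card + 1 ≤ m := by
  obtain ⟨δ, hδ, η, hη, hsub, hedge, hcard⟩ := hq.exists_box isOpen_univ (mem_univ a) hm
  obtain ⟨c', hac', hc'δ, hno⟩ : ∃ c', a < c' ∧ c' ≤ a + δ ∧ ∀ x ∈ Ioo a c', ∀ y,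
      (q x).eval y = 0 → (derivative (q x)).eval y ≠ 0 := by
    have hfin' := ((hfin.image Prod.fst).subset
      (inter_subset_left (t := Ioi a)))
    have hcl' : IsClosed (Prod.fst '' {z : ℝ × ℝ | (q z.1).eval z.2 = 0 ∧
      (derivative (q z.1)).eval z.2 = 0} ∩ Ioi a) := hfin'.isClosed
    have hopen := hcl'.isOpen_compl
    obtain ⟨ε, hε, hball⟩ := Metric.isOpen_iff.1 hopen a (by simp)
    refine ⟨min (a + ε) (a + δ), lt_min (by linarith) (by linarith), min_le_right _ _, ?_⟩
    intro x hx y h0 h1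
    have hxε := hx.2.trans_le (min_le_left _ _)
    refine hball (a := x) ?_ ⟨⟨(x, y), ⟨h0, h1⟩, rfl⟩, hx.1⟩
    rw [Metric.mem_ball, Real.dist_eq, abs_lt]
    exact ⟨by linarith [hx.1], by linarith⟩
  have hu : ∀ t, ∃ u : ℝ × ℝ, t ∈ T → u ∈ connectedComponentIn (region q univ) t ∧
      u.1 ∈ Ioo a c' ∧ u.2 ∈ Ioo (y₀ - η) (y₀ + η) := by
    intro t
    by_cases ht : t ∈ T
    · obtain ⟨u, hu, huU⟩ := mem_closure_iff.1 (hcl t ht)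
        (Iio c' ×ˢ Ioo (y₀ - η) (y₀ + η)) (isOpen_Iio.prod isOpen_Ioo)
        ⟨hac', by simpa using hη⟩
      exact ⟨u, fun _ => ⟨huU, ⟨lt_fst_of_component hq isOpen_univ (hright t ht) u huU, hu.1⟩,
        hu.2⟩⟩
    · exact ⟨t, fun h => absurd h ht⟩
  choose u hu using hu
  obtain ⟨t₀, ht₀, hmin⟩ := T.exists_min_image (fun t => (u t).1) hT
  have hxac : (u t₀).1 ∈ Ioo a c' := (hu t₀ ht₀).2.1
  have hstrip : Ioo a c' ⊆ Ioo (a - δ) (a + δ) := fun x hx =>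
    ⟨by linarith [hx.1], hx.2.trans_le hc'δ⟩
  have hy : ∀ t, ∃ y, t ∈ T → y ∈ Ioo (y₀ - η) (y₀ + η) ∧
      ((u t₀).1, y) ∈ connectedComponentIn (region q univ) t := by
    intro t
    by_cases ht : t ∈ T
    swap
    · exact ⟨0, fun h => absurd h ht⟩
    obtain ⟨hut, hut1, hut2⟩ := hu t ht
    have hur : u t ∈ region q (Ioo a c') := ⟨hut1, (connectedComponentIn_subset _ _ hut).2⟩
    obtain ⟨y, hy⟩ := hq.exists_mem_of_noncritical hno hur (x := (u t₀).1)
      ⟨hxac.1, hmin t ht⟩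
    set W := connectedComponentIn (region q (Ioo a c')) (u t) with hW
    have hWpre : IsPreconnected W := isPreconnected_connectedComponentIn
    have hWs : W ⊆ region q (Ioo a c') := connectedComponentIn_subset _ _
    have huW : u t ∈ W := mem_connectedComponentIn hur
    have hWU : W ⊆ connectedComponentIn (region q univ) t :=
      subset_component hWpre (fun w hw => ⟨mem_univ _, (hWs hw).2⟩) huW hut
    have hWe : ∀ w ∈ W, ∀ y', (y' = y₀ - η ∨ y' = y₀ + η) → w.2 ≠ y' := by
      intro w hw y' hy' hwy
      have hw1 := (hWs hw).1
      have : ((a - δ + a) / 2, w.2) ∈ connectedComponentIn (region q univ) t := by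
        refine horizontal_mem (x := w.1) (fun s hs => ⟨mem_univ _, ?_⟩) (hWU hw)
        rw [uIcc_of_ge (by linarith [hw1.1])] at hs
        have hs' : s ∈ Ioo (a - δ) (a + δ) :=
          ⟨by linarith [hs.1], by linarith [hs.2, hw1.2]⟩
        rw [hwy]
        rcases hy' with rfl | rfl
        · exact (hedge s hs').1
        · exact (hedge s hs').2
      have := hright t ht _ this
      simp only at this
      linarith
    refine ⟨y, fun _ => ⟨⟨?_, ?_⟩, hWU hy⟩⟩
    · by_contra hcon
      push Not at hcon
      obtain ⟨w, hw, hwy⟩ := hWpre.intermediate_value hy huW continuous_snd.continuousOn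
        (show y₀ - η ∈ Icc _ _ from ⟨hcon, hut2.1.le⟩)
      exact hWe w hw _ (Or.inl rfl) hwy
    · by_contra hcon
      push Not at hcon
      obtain ⟨w, hw, hwy⟩ := hWpre.intermediate_value huW hy continuous_snd.continuousOn
        (show y₀ + η ∈ Icc _ _ from ⟨hut2.2.le, hcon⟩)
      exact hWe w hw _ (Or.inr rfl) hwy
  choose y hy using hy
  exact card_succ_le_of_box hq hη hsub hedge (hstrip hxac) hxac.1 (hcard _ (hstrip hxac)) T hT
    hdisj hright y (fun t ht => (hy t ht).1) (fun t ht => (hy t ht).2)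

/-- At most `k + 1` components are unbounded on the left. -/
theorem SliceFamily.card_unbounded_le (hq : SliceFamily q k) (T : Finset (ℝ × ℝ))
    (hreg : ∀ t ∈ T, t ∈ region q univ)
    (hdisj : ∀ t ∈ T, ∀ t' ∈ T, ∀ u, u ∈ connectedComponentIn (region q univ) t →
      u ∈ connectedComponentIn (region q univ) t' → t = t')
    (hunb : ∀ t ∈ T, ∀ c, ∃ u ∈ connectedComponentIn (region q univ) t, u.1 < c) :
    T.card ≤ k + 1 := by
  classical
  obtain ⟨c, hc⟩ : ∃ c, ∀ t ∈ T, c ≤ t.1 := by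
    obtain ⟨c, hc⟩ := (T.image Prod.fst).bddBelow
    exact ⟨c, fun t ht => hc (by simpa using ⟨t.2, ht⟩)⟩
  have hy : ∀ t, ∃ y, t ∈ T → (c, y) ∈ connectedComponentIn (region q univ) t := by
    intro t
    by_cases ht : t ∈ T
    swap
    · exact ⟨0, fun h => absurd h ht⟩
    obtain ⟨u, hu, huc⟩ := hunb t ht c
    obtain ⟨v, hv, hvc⟩ := (isPreconnected_connectedComponentIn (F := region q univ)
      (x := t)).intermediate_value hu (mem_connectedComponentIn (hreg t ht))
      continuous_fst.continuousOn ⟨huc.le, hc t ht⟩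
    exact ⟨v.2, fun _ => by rw [← hvc]; exact hv⟩
  choose y hy using hy
  have hinj : Set.InjOn y T := fun t ht t' ht' h =>
    hdisj t ht t' ht' (c, y t) (hy t ht) (h ▸ hy t' ht')
  rw [← Finset.card_image_of_injOn hinj]
  have hroots : (q c).roots.toFinset.card ≤ k :=
    ((Multiset.toFinset_card_le _).trans (card_roots' _)).trans (hq.natDegree_le c)
  refine (Finset.card_le_of_interleaved (t := (q c).roots.toFinset) ?_).trans
    (Nat.succ_le_succ hroots)
  intro r hr r' hr' hlt _
  obtain ⟨t, ht, rfl⟩ := Finset.mem_image.1 hr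
  obtain ⟨t', ht', rfl⟩ := Finset.mem_image.1 hr'
  by_contra hno
  push Not at hno
  have hseg : ∀ s ∈ uIcc (y t) (y t'), (q c).eval s ≠ 0 := by
    intro s hs h0
    rw [uIcc_of_le hlt.le] at hs
    rcases eq_or_lt_of_le hs.1 with rfl | h1
    · exact (connectedComponentIn_subset _ _ (hy t ht)).2 h0
    rcases eq_or_lt_of_le hs.2 with rfl | h2
    · exact (connectedComponentIn_subset _ _ (hy t' ht')).2 h0
    have := hno s (by simp [hq.ne_zero c, h0]) h1
    linarith
  have := hdisj t ht t' ht' _ (vertical_mem hseg (hy t ht)) (hy t' ht')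
  subst this
  exact lt_irrefl _ hlt

end Births

/-- `z` is a leftmost boundary point of the component of `t` in `F`. -/
def IsBirth (F : Set (ℝ × ℝ)) (t z : ℝ × ℝ) : Prop :=
  z ∈ closure (connectedComponentIn F t) ∧ ∀ u ∈ connectedComponentIn F t, z.1 ≤ u.1

/-- `z` is a rightmost boundary point of the component of `t` in `F`. -/
def IsDeath (F : Set (ℝ × ℝ)) (t z : ℝ × ℝ) : Prop :=
  z ∈ closure (connectedComponentIn F t) ∧ ∀ u ∈ connectedComponentIn F t, u.1 ≤ z.1

/-- The points of `T` lie in pairwise different components of `F`. -/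
def Separated (F : Set (ℝ × ℝ)) (T : Finset (ℝ × ℝ)) : Prop :=
  (∀ t ∈ T, t ∈ F) ∧ ∀ t ∈ T, ∀ t' ∈ T, ∀ u, u ∈ connectedComponentIn F t →
    u ∈ connectedComponentIn F t' → t = t'

/-- The slices vanish at `z` and are increasing in the parameter near `z`. -/
def IncreasingAt (q : ℝ → ℝ[X]) (z : ℝ × ℝ) : Prop :=
  (q z.1).eval z.2 = 0 ∧ ∃ ε > 0, ∀ y, |y - z.2| < ε →
    StrictMonoOn (fun x => (q x).eval y) (Ioo (z.1 - ε) (z.1 + ε))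

/-- The reflection of the plane in the vertical axis. -/
def reflection : ℝ × ℝ ≃ₜ ℝ × ℝ := (Homeomorph.neg ℝ).prodCongr (Homeomorph.refl ℝ)

@[simp] theorem reflection_apply (z : ℝ × ℝ) : reflection z = (-z.1, z.2) := rfl

section Reflection

variable {q : ℝ → ℝ[X]} {k : ℕ}

theorem SliceFamily.comp_neg (hq : SliceFamily q k) : SliceFamily (fun x => q (-x)) k where
  natDegree_le x := hq.natDegree_le _
  ne_zero x := hq.ne_zero _
  continuous_eval m := (hq.continuous_eval m).comp
    (by fun_prop : Continuous fun z : ℝ × ℝ => (-z.1, z.2))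
  bound a := by
    obtain ⟨δ, hδ, B, hB⟩ := hq.bound (-a)
    refine ⟨δ, hδ, B, fun x y hx => hB (-x) y ?_⟩
    rwa [← abs_neg, show -(-x - -a) = x - a by ring]

theorem SliceFamily.neg (hq : SliceFamily q k) : SliceFamily (fun x => -q x) k where
  natDegree_le x := by simpa using hq.natDegree_le x
  ne_zero x := by simpa using hq.ne_zero x
  continuous_eval m := by
    have := (hq.continuous_eval m).neg
    simp only [iterate_derivative_neg, eval_neg]
    exact this
  bound a := by simpa using hq.bound a

theorem region_neg (q : ℝ → ℝ[X]) (I : Set ℝ) : region (fun x => -q x) I = region q I := by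
  simp [region]

theorem image_reflection_region (q : ℝ → ℝ[X]) :
    reflection '' region q univ = region (fun x => q (-x)) univ := by
  ext z
  constructor
  · rintro ⟨w, hw, rfl⟩
    simpa [region] using hw
  · intro hz
    exact ⟨(-z.1, z.2), by simpa [region] using hz, by simp⟩

theorem isBirth_reflection {F : Set (ℝ × ℝ)} {t z : ℝ × ℝ} (ht : t ∈ F) :
    IsBirth (reflection '' F) (reflection t) (reflection z) ↔ IsDeath F t z := by
  rw [IsBirth, IsDeath, ← reflection.image_connectedComponentIn ht, ← reflection.image_closure,
    reflection.injective.mem_set_image, forall_mem_image]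
  simp

theorem Separated.image {F : Set (ℝ × ℝ)} {T : Finset (ℝ × ℝ)} (hT : Separated F T)
    (e : ℝ × ℝ ≃ₜ ℝ × ℝ) : Separated (e '' F) (T.map e.toEquiv.toEmbedding) := by
  constructor
  · intro t ht
    obtain ⟨s, hs, rfl⟩ := Finset.mem_map.1 ht
    exact ⟨s, hT.1 s hs, rfl⟩
  · intro t ht t' ht' u hu hu'
    obtain ⟨s, hs, rfl⟩ := Finset.mem_map.1 ht
    obtain ⟨s', hs', rfl⟩ := Finset.mem_map.1 ht'
    simp only [Equiv.coe_toEmbedding, Homeomorph.coe_toEquiv] at hu hu' ⊢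
    rw [← e.image_connectedComponentIn (hT.1 _ hs)] at hu
    rw [← e.image_connectedComponentIn (hT.1 _ hs')] at hu'
    obtain ⟨v, hv, rfl⟩ := hu
    rw [e.injective.mem_set_image] at hu'
    rw [hT.2 s hs s' hs' v hv hu']

theorem Separated.mono {F : Set (ℝ × ℝ)} {T T' : Finset (ℝ × ℝ)} (hT : Separated F T)
    (h : T' ⊆ T) : Separated F T' :=
  ⟨fun t ht => hT.1 t (h ht), fun t ht t' ht' => hT.2 t (h ht) t' (h ht')⟩

end Reflection

section Smooth

variable {q : ℝ → ℝ[X]} {k : ℕ}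

theorem IncreasingAt.reflection_neg {z : ℝ × ℝ} (h : IncreasingAt q z) :
    IncreasingAt (fun x => -q (-x)) (reflection z) := by
  obtain ⟨h0, ε, hε, hmono⟩ := h
  refine ⟨by simpa using h0, ε, hε, fun y hy x hx x' hx' hlt => ?_⟩
  have := hmono y hy (a := -x') (b := -x) ⟨?_, ?_⟩ ⟨?_, ?_⟩ (neg_lt_neg hlt)
  · simpa using this
  all_goals
    simp only [reflection_apply, mem_Ioo] at hx hx'
    linarith [hx.1, hx.2, hx'.1, hx'.2]

theorem IncreasingAt.exists_forall_pos_mem {t z : ℝ × ℝ}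
    (h : IncreasingAt q z) (hb : IsBirth (region q univ) t z) :
    ∃ ε > 0, ∀ w : ℝ × ℝ, |w.1 - z.1| < ε → |w.2 - z.2| < ε → 0 < (q w.1).eval w.2 →
      w ∈ connectedComponentIn (region q univ) t := by
  obtain ⟨h0, ε, hε, hmono⟩ := h
  have hpos : 0 < (q (z.1 + ε / 2)).eval z.2 := by
    rw [← h0]
    exact hmono z.2 (by simpa using hε) ⟨by linarith, by linarith⟩ ⟨by linarith, by linarith⟩
      (by linarith)
  have hcont : Continuous fun y => (q (z.1 + ε / 2)).eval y := Polynomial.continuous _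
  obtain ⟨η, hη, hη'⟩ := Metric.eventually_nhds_iff.1
    (hcont.continuousAt.eventually (lt_mem_nhds hpos))
  obtain ⟨ε', hε', hle, hleη⟩ : ∃ ε' > 0, ε' ≤ ε / 2 ∧ ε' ≤ η :=
    ⟨min (ε / 2) η, lt_min (by linarith) hη, min_le_left _ _, min_le_right _ _⟩
  have hlink : ∀ w : ℝ × ℝ, |w.1 - z.1| < ε' → |w.2 - z.2| < ε' → 0 < (q w.1).eval w.2 →
      ∀ s ∈ uIcc w.1 (z.1 + ε / 2), s ∈ univ ∧ (q s).eval w.2 ≠ 0 := by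
    intro w h1 h2 hw s hs
    rw [abs_lt] at h1
    rw [uIcc_of_le (by linarith [h1.2])] at hs
    refine ⟨mem_univ _, ne_of_gt (hw.trans_le ?_)⟩
    exact (hmono w.2 (by linarith)).monotoneOn ⟨by linarith, by linarith⟩
      ⟨by linarith [hs.1], by linarith [hs.2]⟩ hs.1
  have hvert : ∀ y y', |y - z.2| < ε' → |y' - z.2| < ε' →
      ∀ s ∈ uIcc y y', (q (z.1 + ε / 2)).eval s ≠ 0 := by
    intro y y' hy hy' s hs
    refine ne_of_gt (hη' (y := s) ?_)
    rw [Real.dist_eq, abs_lt]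
    rw [abs_lt] at hy hy'
    rcases le_total y y' with hyy | hyy
    · rw [uIcc_of_le hyy] at hs; constructor <;> linarith [hs.1, hs.2]
    · rw [uIcc_of_ge hyy] at hs; constructor <;> linarith [hs.1, hs.2]
  obtain ⟨u, ⟨hu1, hu2⟩, huU⟩ := mem_closure_iff.1 hb.1
    (Ioo (z.1 - ε') (z.1 + ε') ×ˢ Ioo (z.2 - ε') (z.2 + ε')) (isOpen_Ioo.prod isOpen_Ioo)
    ⟨by simpa using hε', by simpa using hε'⟩
  have hu1' : |u.1 - z.1| < ε' := abs_lt.2 ⟨by linarith [hu1.1], by linarith [hu1.2]⟩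
  have hu2' : |u.2 - z.2| < ε' := abs_lt.2 ⟨by linarith [hu2.1], by linarith [hu2.2]⟩
  have hupos : 0 < (q u.1).eval u.2 := by
    by_contra hcon
    push Not at hcon
    have hneg := lt_of_le_of_ne hcon (connectedComponentIn_subset _ _ huU).2
    have : (z.1 - ε' / 2, u.2) ∈ connectedComponentIn (region q univ) t := by
      refine horizontal_mem (x := u.1) (fun s hs => ⟨mem_univ _, ?_⟩) huU
      rw [uIcc_of_ge (by linarith [hb.2 u huU])] at hs
      refine ne_of_lt (lt_of_le_of_lt ?_ hneg)
      exact (hmono u.2 (by linarith)).monotoneOn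
        ⟨by linarith [hs.1], by linarith [hs.2, hu1.2]⟩
        ⟨by linarith [hu1.1], by linarith [hu1.2]⟩ hs.2
    have := hb.2 _ this
    simp only at this
    linarith
  refine ⟨ε', hε', fun w h1 h2 hw => ?_⟩
  have e1 : (z.1 + ε / 2, u.2) ∈ connectedComponentIn (region q univ) t :=
    horizontal_mem (hlink u hu1' hu2' hupos) huU
  have e2 := vertical_mem (hvert u.2 w.2 hu2' h2) e1
  refine horizontal_mem (x' := w.1) (fun s hs => ?_) e2
  exact hlink w h1 h2 hw s (by rwa [uIcc_comm])

theorem IncreasingAt.birth_unique {T : Finset (ℝ × ℝ)}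
    (hT : Separated (region q univ) T) {z : ℝ × ℝ} (h : IncreasingAt q z) {t t' : ℝ × ℝ}
    (ht : t ∈ T) (ht' : t' ∈ T) (hb : IsBirth (region q univ) t z)
    (hb' : IsBirth (region q univ) t' z) : t = t' := by
  obtain ⟨ε, hε, h1⟩ := h.exists_forall_pos_mem hb
  obtain ⟨ε', hε', h2⟩ := h.exists_forall_pos_mem hb'
  obtain ⟨h0, δ, hδ, hmono⟩ := h
  obtain ⟨s, hs, hs1, hs2, hs3⟩ : ∃ s > 0, s < ε ∧ s < ε' ∧ s < δ :=
    ⟨min ε (min ε' δ) / 2, by positivity, by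
      have := min_le_left ε (min ε' δ); have : 0 < min ε (min ε' δ) := by positivity
      linarith, by
      have := (min_le_right ε (min ε' δ)).trans (min_le_left _ _)
      have : 0 < min ε (min ε' δ) := by positivity
      linarith, by
      have := (min_le_right ε (min ε' δ)).trans (min_le_right _ _)
      have : 0 < min ε (min ε' δ) := by positivity
      linarith⟩
  have hpos : 0 < (q (z.1 + s)).eval z.2 := by
    rw [← h0]
    exact hmono z.2 (by simpa using hδ) ⟨by linarith, by linarith⟩ ⟨by linarith, by linarith⟩
      (by linarith)
  exact hT.2 t ht t' ht' (z.1 + s, z.2) (h1 _ (by simpa [abs_of_pos hs] using hs1) (by simpa using hε) hpos)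
    (h2 _ (by simpa [abs_of_pos hs] using hs2) (by simpa using hε') hpos)

theorem IncreasingAt.exists_forall_neg_mem {t z : ℝ × ℝ}
    (ht : t ∈ region q univ) (h : IncreasingAt q z) (hb : IsDeath (region q univ) t z) :
    ∃ ε > 0, ∀ w : ℝ × ℝ, |w.1 - z.1| < ε → |w.2 - z.2| < ε → (q w.1).eval w.2 < 0 →
      w ∈ connectedComponentIn (region q univ) t := by
  have hreg : region (fun x => -q (-x)) univ = reflection '' region q univ := by
    rw [image_reflection_region, region_neg (fun x => q (-x))]
  obtain ⟨ε, hε, hw⟩ := h.reflection_neg.exists_forall_pos_mem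
    (t := reflection t) (by rw [hreg, isBirth_reflection ht]; exact hb)
  refine ⟨ε, hε, fun w h1 h2 h3 => ?_⟩
  have := hw (reflection w) ?_ (by simpa using h2) (by simpa using h3)
  · rwa [hreg, ← reflection.image_connectedComponentIn ht,
      reflection.injective.mem_set_image] at this
  · simp only [reflection_apply]
    rwa [← abs_neg, show -(-w.1 - -z.1) = w.1 - z.1 by ring]

theorem IncreasingAt.not_birth_and_death (hq : SliceFamily q k) {z : ℝ × ℝ}
    (h : IncreasingAt q z) {t t' : ℝ × ℝ} (ht' : t' ∈ region q univ)
    (hb : IsBirth (region q univ) t z) : ¬ IsDeath (region q univ) t' z := by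
  intro hd
  obtain ⟨ε, hε, h1⟩ := h.exists_forall_pos_mem hb
  obtain ⟨ε', hε', h2⟩ := h.exists_forall_neg_mem ht' hd
  obtain ⟨y, hy, hy'⟩ : ∃ y ∈ Ioo z.2 (z.2 + min ε ε'), (q z.1).eval y ≠ 0 := by
    by_contra hcon
    push Not at hcon
    refine (Ioo_infinite (show z.2 < z.2 + min ε ε' by
      have := lt_min hε hε'; linarith)) ((q z.1).roots.toFinset.finite_toSet.subset ?_)
    intro y hy
    simpa [hq.ne_zero] using hcon y hy
  have hyε : |y - z.2| < min ε ε' := abs_lt.2 ⟨by linarith [hy.1, hy.2], by linarith [hy.2]⟩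
  rcases lt_or_gt_of_ne hy' with hlt | hgt
  · have hmem := h2 (z.1, y) (by simpa using hε') (lt_of_lt_of_le hyε (min_le_right _ _)) hlt
    have hb2 : IsBirth (region (fun x => q (-x)) univ) (reflection t') (reflection z) := by
      rw [← image_reflection_region, isBirth_reflection ht']; exact hd
    have := lt_fst_of_component hq.comp_neg isOpen_univ hb2.2 (reflection (z.1, y)) (by
      rw [← image_reflection_region, ← reflection.image_connectedComponentIn ht',
        reflection.injective.mem_set_image]; exact hmem)
    simp at this
  · have hmem := h1 (z.1, y) (by simpa using hε) (lt_of_lt_of_le hyε (min_le_left _ _)) hgt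
    exact lt_irrefl _ (lt_fst_of_component hq isOpen_univ hb.2 (z.1, y) hmem)

theorem IncreasingAt.card_add_card_le (hq : SliceFamily q k) {T B D : Finset (ℝ × ℝ)}
    (hT : Separated (region q univ) T) {z : ℝ × ℝ} (h : IncreasingAt q z)
    (hBT : B ⊆ T) (hDT : D ⊆ T) (hB : ∀ t ∈ B, IsBirth (region q univ) t z)
    (hD : ∀ t ∈ D, IsDeath (region q univ) t z) : B.card + D.card ≤ 1 := by
  have hB1 : B.card ≤ 1 := Finset.card_le_one.2 fun t ht t' ht' =>
    h.birth_unique hT (hBT ht) (hBT ht') (hB t ht) (hB t' ht')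
  have hD1 : D.card ≤ 1 := by
    refine Finset.card_le_one.2 fun t ht t' ht' => ?_
    have hreg : region (fun x => -q (-x)) univ = reflection '' region q univ := by
      rw [image_reflection_region, region_neg (fun x => q (-x))]
    refine reflection.injective (h.reflection_neg.birth_unique
      (T := T.map reflection.toEquiv.toEmbedding) (hreg ▸ hT.image reflection)
      (Finset.mem_map_of_mem _ (hDT ht)) (Finset.mem_map_of_mem _ (hDT ht')) ?_ ?_)
    · rw [hreg]
      exact (isBirth_reflection (hT.1 t (hDT ht))).2 (hD t ht)
    · rw [hreg]
      exact (isBirth_reflection (hT.1 t' (hDT ht'))).2 (hD t' ht')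
  rcases B.eq_empty_or_nonempty with rfl | ⟨t, ht⟩
  · simpa using hD1
  rcases D.eq_empty_or_nonempty with rfl | ⟨t', ht'⟩
  · simpa using hB1
  exact absurd (hD t' ht') (h.not_birth_and_death hq (hT.1 t' (hDT ht')) (hB t ht))

end Smooth

section Counting

variable {q : ℝ → ℝ[X]} {k : ℕ}

/-- The common zeros of the slices and their derivatives. -/
def criticalSet (q : ℝ → ℝ[X]) : Set (ℝ × ℝ) :=
  {z | (q z.1).eval z.2 = 0 ∧ (derivative (q z.1)).eval z.2 = 0}

theorem criticalSet_comp_neg (q : ℝ → ℝ[X]) :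
    criticalSet (fun x => q (-x)) = reflection '' criticalSet q := by
  ext z
  constructor
  · intro hz
    exact ⟨(-z.1, z.2), by simpa [criticalSet] using hz, by simp⟩
  · rintro ⟨w, hw, rfl⟩
    simpa [criticalSet] using hw

theorem SliceFamily.exists_isBirth (hq : SliceFamily q k) {t : ℝ × ℝ} (ht : t ∈ region q univ)
    (hbdd : ¬ ∀ c, ∃ u ∈ connectedComponentIn (region q univ) t, u.1 < c) :
    ∃ z ∈ criticalSet q, IsBirth (region q univ) t z := by
  push Not at hbdd
  obtain ⟨c, hc⟩ := hbdd
  set U := connectedComponentIn (region q univ) t with hU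
  have hbb : BddBelow (Prod.fst '' U) := ⟨c, by rintro _ ⟨w, hw, rfl⟩; exact hc w hw⟩
  have hne : (Prod.fst '' U).Nonempty := ⟨_, t, mem_connectedComponentIn ht, rfl⟩
  have hle : ∀ u ∈ U, sInf (Prod.fst '' U) ≤ u.1 := fun w hw => csInf_le hbb ⟨w, hw, rfl⟩
  obtain ⟨y₀, hcl, h0, h1⟩ := hq.exists_leftmost isOpen_univ (mem_univ _) (t := t) hle
    (fun ε hε => by
      obtain ⟨_, ⟨w, hw, rfl⟩, hlt⟩ := exists_lt_of_csInf_lt hne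
        (show sInf (Prod.fst '' U) < sInf (Prod.fst '' U) + ε by linarith)
      exact ⟨w, hw, hlt⟩)
  exact ⟨_, ⟨h0, h1⟩, hcl, hle⟩

/-- All but `k + 1` of the components are born at critical points. -/
theorem SliceFamily.card_le_births (hq : SliceFamily q k) {T : Finset (ℝ × ℝ)}
    (hT : Separated (region q univ) T) :
    ∃ S ⊆ T, T.card ≤ (k + 1) + S.card ∧
      ∃ b : ℝ × ℝ → ℝ × ℝ, ∀ t ∈ S, b t ∈ criticalSet q ∧ IsBirth (region q univ) t (b t) := by
  classical
  let L := T.filter (fun t => ∀ c, ∃ u ∈ connectedComponentIn (region q univ) t, u.1 < c)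
  have hLT : L ⊆ T := Finset.filter_subset _ _
  have hL : L.card ≤ k + 1 := hq.card_unbounded_le L (fun t ht => hT.1 t (hLT ht))
    (hT.mono hLT).2 (fun t ht => (Finset.mem_filter.1 ht).2)
  have hb : ∀ t, ∃ z, t ∈ T \ L → z ∈ criticalSet q ∧ IsBirth (region q univ) t z := by
    intro t
    by_cases ht : t ∈ T \ L
    · rw [Finset.mem_sdiff] at ht
      obtain ⟨z, hz, hz'⟩ := hq.exists_isBirth (hT.1 t ht.1)
        (fun h => ht.2 (Finset.mem_filter.2 ⟨ht.1, h⟩))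
      exact ⟨z, fun _ => ⟨hz, hz'⟩⟩
    · exact ⟨t, fun h => absurd h ht⟩
  choose b hb using hb
  refine ⟨T \ L, Finset.sdiff_subset, ?_, b, hb⟩
  have := Finset.card_sdiff_add_card_eq_card hLT
  omega

theorem SliceFamily.card_le_deaths (hq : SliceFamily q k) {T : Finset (ℝ × ℝ)}
    (hT : Separated (region q univ) T) :
    ∃ S ⊆ T, T.card ≤ (k + 1) + S.card ∧
      ∃ b : ℝ × ℝ → ℝ × ℝ, ∀ t ∈ S, b t ∈ criticalSet q ∧ IsDeath (region q univ) t (b t) := by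
  have hT' := hT.image reflection
  rw [image_reflection_region] at hT'
  obtain ⟨S, hS, hcard, b, hb⟩ := hq.comp_neg.card_le_births hT'
  have hSinv : ∀ t ∈ S.map reflection.symm.toEquiv.toEmbedding, t ∈ T ∧ reflection t ∈ S := by
    intro t ht
    obtain ⟨s, hs, rfl⟩ := Finset.mem_map.1 ht
    obtain ⟨r, hr, rfl⟩ := Finset.mem_map.1 (hS hs)
    simp only [Equiv.coe_toEmbedding, Homeomorph.coe_toEquiv] at hs ⊢
    rw [Homeomorph.symm_apply_apply]
    exact ⟨hr, hs⟩
  refine ⟨S.map reflection.symm.toEquiv.toEmbedding, fun t ht => (hSinv t ht).1,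
    by simpa using hcard, fun t => reflection (b (reflection t)), fun t ht => ?_⟩
  obtain ⟨h1, h2⟩ := hb _ (hSinv t ht).2
  have hinv : ∀ z, reflection (reflection z) = z := fun z => by simp
  constructor
  · rw [criticalSet_comp_neg] at h1
    obtain ⟨w, hw, hwb⟩ := h1
    show reflection (b (reflection t)) ∈ criticalSet q
    rw [← hwb, hinv]
    exact hw
  · show IsDeath (region q univ) t (reflection (b (reflection t)))
    rw [← isBirth_reflection (hT.1 t (hSinv t ht).1), hinv, image_reflection_region]
    exact h2

theorem SliceFamily.card_births_le (hq : SliceFamily q k) (hfin : (criticalSet q).Finite)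
    {z : ℝ × ℝ} {m : ℕ} (hm : (derivative^[m] (q z.1)).eval z.2 ≠ 0) {B : Finset (ℝ × ℝ)}
    (hsep : Separated (region q univ) B) (hB : ∀ t ∈ B, IsBirth (region q univ) t z) :
    B.card ≤ m - 1 := by
  rcases B.eq_empty_or_nonempty with rfl | hne
  · simp
  have := hq.card_births_lt hm hfin B hne hsep.2 (fun t ht => (hB t ht).2)
    (fun t ht => (hB t ht).1)
  omega

theorem SliceFamily.card_deaths_le (hq : SliceFamily q k) (hfin : (criticalSet q).Finite)
    {z : ℝ × ℝ} {m : ℕ} (hm : (derivative^[m] (q z.1)).eval z.2 ≠ 0) {D : Finset (ℝ × ℝ)}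
    (hsep : Separated (region q univ) D) (hD : ∀ t ∈ D, IsDeath (region q univ) t z) :
    D.card ≤ m - 1 := by
  have hsep' := hsep.image reflection
  rw [image_reflection_region] at hsep'
  have := hq.comp_neg.card_births_le (z := reflection z) (m := m)
    (by rw [criticalSet_comp_neg]; exact hfin.image _) (by simpa using hm) hsep' (by
      intro t ht
      obtain ⟨s, hs, rfl⟩ := Finset.mem_map.1 ht
      rw [← image_reflection_region]
      exact (isBirth_reflection (hsep.1 s hs)).2 (hD s hs))
  simpa using this

/-- Components of the complement of the zero set are counted, twice, by weighted critical points
of the projection to the first coordinate. -/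
theorem SliceFamily.two_mul_card_le (hq : SliceFamily q k) (Z : Finset (ℝ × ℝ))
    (hZ : criticalSet q = Z) (w : ℝ × ℝ → ℕ)
    (hw : ∀ z ∈ Z, (∃ m, w z = 2 * (m - 1) ∧ (derivative^[m] (q z.1)).eval z.2 ≠ 0) ∨
      (w z = 1 ∧ (IncreasingAt q z ∨ IncreasingAt (fun x => -q x) z)))
    {T : Finset (ℝ × ℝ)} (hT : Separated (region q univ) T) :
    2 * T.card ≤ 2 * (k + 1) + ∑ z ∈ Z, w z := by
  classical
  have hfin : (criticalSet q).Finite := hZ ▸ Z.finite_toSet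
  obtain ⟨S, hST, hS, b, hb⟩ := hq.card_le_births hT
  obtain ⟨S', hST', hS', d, hd⟩ := hq.card_le_deaths hT
  have e1 : S.card = ∑ z ∈ Z, (S.filter (fun t => b t = z)).card :=
    Finset.card_eq_sum_card_fiberwise fun t ht => by simpa [← hZ] using (hb t ht).1
  have e2 : S'.card = ∑ z ∈ Z, (S'.filter (fun t => d t = z)).card :=
    Finset.card_eq_sum_card_fiberwise fun t ht => by simpa [← hZ] using (hd t ht).1
  have e3 : S.card + S'.card ≤ ∑ z ∈ Z, w z := by
    rw [e1, e2, ← Finset.sum_add_distrib]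
    refine Finset.sum_le_sum fun z hz => ?_
    have hB : ∀ t ∈ S.filter (fun t => b t = z), IsBirth (region q univ) t z := by
      intro t ht
      obtain ⟨hts, rfl⟩ := Finset.mem_filter.1 ht
      exact (hb t hts).2
    have hD : ∀ t ∈ S'.filter (fun t => d t = z), IsDeath (region q univ) t z := by
      intro t ht
      obtain ⟨hts, rfl⟩ := Finset.mem_filter.1 ht
      exact (hd t hts).2
    have hBT := (Finset.filter_subset (fun t => b t = z) S).trans hST
    have hDT := (Finset.filter_subset (fun t => d t = z) S').trans hST'
    rcases hw z hz with ⟨m, hwm, hm⟩ | ⟨hw1, hinc | hdec⟩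
    · have := hq.card_births_le hfin hm (hT.mono hBT) hB
      have := hq.card_deaths_le hfin hm (hT.mono hDT) hD
      omega
    · rw [hw1]
      exact hinc.card_add_card_le hq hT hBT hDT hB hD
    · rw [hw1]
      refine hdec.card_add_card_le hq.neg ?_ hBT hDT ?_ ?_ <;> rwa [region_neg]
  omega

end Counting

section Slice

/-- The restriction of a bivariate polynomial to the vertical line through `x`. -/
noncomputable def slice (p : MvPolynomial (Fin 2) ℝ) (x : ℝ) : ℝ[X] :=
  MvPolynomial.aeval ![C x, X] p

theorem eval_slice (p : MvPolynomial (Fin 2) ℝ) (x y : ℝ) :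
    (slice p x).eval y = MvPolynomial.eval ![x, y] p := by
  induction p using MvPolynomial.induction_on with
  | C a => simp [slice]
  | add p q hp hq => simp_all [slice]
  | mul_X p i hp => fin_cases i <;> simp_all [slice]

theorem derivative_slice (p : MvPolynomial (Fin 2) ℝ) (x : ℝ) :
    derivative (slice p x) = slice (MvPolynomial.pderiv 1 p) x := by
  induction p using MvPolynomial.induction_on with
  | C a => simp [slice]
  | add p q hp hq => simp_all [slice]
  | mul_X p i hp => fin_cases i <;> simp_all [slice, Derivation.leibniz] <;> ring

theorem iterate_derivative_slice (p : MvPolynomial (Fin 2) ℝ) (x : ℝ) (m : ℕ) :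
    derivative^[m] (slice p x) = slice ((MvPolynomial.pderiv 1)^[m] p) x := by
  induction m generalizing p with
  | zero => rfl
  | succ m ih => rw [Function.iterate_succ_apply, derivative_slice, ih,
      Function.iterate_succ_apply]

theorem natDegree_slice_le (p : MvPolynomial (Fin 2) ℝ) (x : ℝ) :
    (slice p x).natDegree ≤ p.totalDegree := by
  have := MvPolynomial.aeval_natDegree_le p le_rfl ![C x, X] (n := 1) (by
    intro i; fin_cases i <;> simp)
  simpa [slice] using this

theorem coeff_slice (p : MvPolynomial (Fin 2) ℝ) (x : ℝ) {k : ℕ} (hk : p.totalDegree ≤ k) :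
    (slice p x).coeff k = p.coeff (Finsupp.single 1 k) := by
  rw [slice, MvPolynomial.aeval_def, MvPolynomial.eval₂_eq', Polynomial.finsetSum_coeff,
    Finset.sum_eq_single (Finsupp.single 1 k)]
  · simp
  · intro d hd hne
    simp only [Fin.prod_univ_two, Matrix.cons_val_zero, Matrix.cons_val_one,
      algebraMap_eq]
    rw [← C_pow, ← mul_assoc, ← C_mul, coeff_C_mul, coeff_X_pow, if_neg, mul_zero]
    rintro rfl
    have h1 := (MvPolynomial.le_totalDegree hd).trans hk
    rw [Finsupp.sum_fintype _ _ (by simp), Fin.sum_univ_two] at h1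
    refine hne (Finsupp.ext fun i => ?_)
    fin_cases i
    · simp; omega
    · simp
  · intro h
    simp [MvPolynomial.notMem_support_iff.1 h]

theorem continuous_coeff_slice (p : MvPolynomial (Fin 2) ℝ) (i : ℕ) :
    Continuous fun x => (slice p x).coeff i := by
  induction p using MvPolynomial.induction_on generalizing i with
  | C a => simpa [slice] using continuous_const
  | add p q hp hq =>
    simp only [slice, map_add, coeff_add] at hp hq ⊢
    exact (hp i).add (hq i)
  | mul_X p j hp =>
    fin_cases j
    · simp only [slice, map_mul, MvPolynomial.aeval_X, Fin.zero_eta, Matrix.cons_val_zero,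
        coeff_mul_C] at hp ⊢
      exact (hp i).mul continuous_id
    · cases i with
      | zero => simpa [slice] using continuous_const
      | succ i => simpa [slice, coeff_mul_X] using hp i

theorem sliceFamily_slice {p : MvPolynomial (Fin 2) ℝ} {k : ℕ} (hp : p.totalDegree ≤ k)
    (hc : p.coeff (Finsupp.single 1 k) ≠ 0) : SliceFamily (slice p) k := by
  have hdeg : ∀ x, (slice p x).natDegree = k := fun x =>
    natDegree_eq_of_le_of_coeff_ne_zero ((natDegree_slice_le p x).trans hp)
      (by rwa [coeff_slice p x hp])
  have hlead : ∀ x, (slice p x).leadingCoeff = p.coeff (Finsupp.single 1 k) := fun x => by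
    rw [leadingCoeff, hdeg, coeff_slice p x hp]
  have h0 : ∀ x, slice p x ≠ 0 := fun x h => hc (by rw [← hlead x, h, leadingCoeff_zero])
  refine ⟨fun x => (hdeg x).le, h0, fun m => ?_, fun a => ?_⟩
  · simp only [iterate_derivative_slice, eval_slice]
    exact (MvPolynomial.continuous_eval _).comp (by fun_prop)
  · have hcont : Continuous fun x => (slice p x).cauchyBound := by
      simp only [cauchyBound, hdeg, hlead]
      refine Continuous.add (Continuous.div_const (Continuous.finset_sup_apply fun i _ =>
        (continuous_coeff_slice p i).nnnorm) _) continuous_const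
    obtain ⟨δ, hδ, h⟩ := Metric.eventually_nhds_iff.1 (hcont.continuousAt (x := a)
      |>.eventually (gt_mem_nhds (lt_add_one _)))
    refine ⟨δ, hδ, (slice p a).cauchyBound + 1, fun x y hx hy hroot => ?_⟩
    have h1 := IsRoot.norm_lt_cauchyBound (h0 x) hroot
    have h2 : ((slice p x).cauchyBound : ℝ) < (slice p a).cauchyBound + 1 := by
      exact_mod_cast h (y := x) (by rwa [Real.dist_eq])
    rw [← Real.norm_eq_abs] at hy
    have h3 : ‖y‖ < ((slice p x).cauchyBound : ℝ) := by exact_mod_cast h1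
    linarith

theorem hasDerivAt_eval (p : MvPolynomial (Fin 2) ℝ) (x y : ℝ) :
    HasDerivAt (fun x => MvPolynomial.eval ![x, y] p)
      (MvPolynomial.eval ![x, y] (MvPolynomial.pderiv 0 p)) x := by
  induction p using MvPolynomial.induction_on with
  | C a => simpa using hasDerivAt_const x a
  | add p q hp hq => simpa using hp.fun_add hq
  | mul_X p i hp =>
    fin_cases i
    · simpa [Derivation.leibniz, add_comm, mul_comm] using hp.fun_mul (hasDerivAt_id' x)
    · simpa [Derivation.leibniz, mul_comm] using hp.fun_mul (hasDerivAt_const x y)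

theorem increasingAt_slice {p : MvPolynomial (Fin 2) ℝ} {z : ℝ × ℝ}
    (h0 : MvPolynomial.eval ![z.1, z.2] p = 0)
    (h1 : 0 < MvPolynomial.eval ![z.1, z.2] (MvPolynomial.pderiv 0 p)) :
    IncreasingAt (slice p) z := by
  refine ⟨by rwa [eval_slice], ?_⟩
  have hcont : Continuous fun w : ℝ × ℝ =>
      MvPolynomial.eval ![w.1, w.2] (MvPolynomial.pderiv 0 p) :=
    (MvPolynomial.continuous_eval _).comp (by fun_prop)
  obtain ⟨ε, hε, h⟩ := Metric.eventually_nhds_iff.1 (hcont.continuousAt (x := z)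
    |>.eventually (lt_mem_nhds h1))
  refine ⟨ε, hε, fun y hy => ?_⟩
  simp only [eval_slice]
  refine strictMonoOn_of_deriv_pos (convex_Ioo _ _)
    (fun x _ => (hasDerivAt_eval p x y).continuousAt.continuousWithinAt) fun x hx => ?_
  rw [(hasDerivAt_eval p x y).deriv]
  rw [interior_Ioo] at hx
  refine h (y := (x, y)) ?_
  rw [Prod.dist_eq, max_lt_iff, Real.dist_eq, Real.dist_eq]
  exact ⟨abs_lt.2 ⟨by linarith [hx.1], by linarith [hx.2]⟩, hy⟩

theorem slice_neg (p : MvPolynomial (Fin 2) ℝ) : slice (-p) = fun x => -slice p x := by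
  ext1 x; simp [slice]

end Slice

section Bezout

open MvPolynomial Module

theorem sum_eq_add (d : Fin 2 →₀ ℕ) : (d.sum fun _ e => e) = d 0 + d 1 := by
  rw [Finsupp.sum_fintype _ _ (by simp), Fin.sum_univ_two]

theorem two_mul_finrank_restrictTotalDegree (N : ℕ) :
    2 * finrank ℝ (restrictTotalDegree (Fin 2) ℝ N) = (N + 1) * (N + 2) := by
  rw [restrictTotalDegree, finrank_eq_nat_card_basis (basisRestrictSupport ℝ _)]
  let e : {d : Fin 2 →₀ ℕ | (d.sum fun _ e => e) ≤ N} ≃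
      ((Finset.range (N + 1)).sigma fun n => Finset.HasAntidiagonal.antidiagonal n) :=
    { toFun := fun d => ⟨⟨d.1 0 + d.1 1, (d.1 0, d.1 1)⟩, by
        have := d.2
        simp only [mem_ofPred_eq, sum_eq_add] at this
        simp; omega⟩
      invFun := fun s => ⟨Finsupp.single 0 s.1.2.1 + Finsupp.single 1 s.1.2.2, by
        have := s.2
        simp only [Finset.mem_sigma, Finset.mem_range, Finset.HasAntidiagonal.mem_antidiagonal] at this
        simp [sum_eq_add]; omega⟩
      left_inv := fun d => by
        ext i; fin_cases i <;> simp
      right_inv := fun ⟨⟨n, i, j⟩, h⟩ => by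
        simp only [Finset.mem_sigma, Finset.mem_range, Finset.HasAntidiagonal.mem_antidiagonal] at h
        simp [← h.2] }
  rw [Nat.card_congr e, Nat.card_eq_fintype_card, Fintype.card_coe]
  simp only [Finset.card_sigma, Finset.Nat.card_antidiagonal]
  have := Finset.sum_range_id_mul_two (N + 2)
  rw [Finset.sum_range_succ'] at this
  simp at this
  linarith

/-- A form of Bezout's bound: linear conditions vanishing on the ideal generated by two coprime
polynomials. -/
theorem finrank_le_mul_totalDegree {p g : MvPolynomial (Fin 2) ℝ} (hp : p ≠ 0) (hg : g ≠ 0)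
    (h : IsRelPrime p g) {E : Type*} [AddCommGroup E] [Module ℝ E] [FiniteDimensional ℝ E]
    (Ψ : MvPolynomial (Fin 2) ℝ →ₗ[ℝ] E) (hs : Function.Surjective Ψ)
    (h1 : ∀ u, Ψ (p * u) = 0) (h2 : ∀ u, Ψ (g * u) = 0) :
    finrank ℝ E ≤ p.totalDegree * g.totalDegree := by
  set k := p.totalDegree with hk
  set l := g.totalDegree with hl
  let b := finBasis ℝ E
  choose s hsb using fun i => hs (b i)
  let N := Finset.univ.sup (fun i => (s i).totalDegree)
  let P := fun n => restrictTotalDegree (Fin 2) ℝ n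
  have hP : ∀ n (u : MvPolynomial (Fin 2) ℝ), u ∈ P n ↔ u.totalDegree ≤ n := fun n u =>
    mem_restrictTotalDegree _ _ _
  have hsurj : Function.Surjective (Ψ.domRestrict (P (N + k + l))) := by
    rw [← LinearMap.range_eq_top, eq_top_iff, ← b.span_eq, Submodule.span_le]
    rintro _ ⟨i, rfl⟩
    refine ⟨⟨s i, (hP _ _).2 ?_⟩, hsb i⟩
    have : (s i).totalDegree ≤ N := Finset.le_sup (f := fun i => (s i).totalDegree)
      (Finset.mem_univ i)
    omega
  let L := fun u : MvPolynomial (Fin 2) ℝ => LinearMap.mulLeft ℝ u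
  have hL : ∀ u : MvPolynomial (Fin 2) ℝ, u ≠ 0 → Function.Injective (L u) := fun u hu =>
    mul_right_injective₀ hu
  have hLf : ∀ u : MvPolynomial (Fin 2) ℝ, u ≠ 0 → ∀ n,
      finrank ℝ ((P n).map (L u)) = finrank ℝ (P n) := fun u hu n =>
    ((P n).equivMapOfInjective _ (hL u hu)).finrank_eq.symm
  have hle : ((P (N + l)).map (L p)) ⊔ ((P (N + k)).map (L g)) ≤ P (N + k + l) := by
    rw [sup_le_iff]
    constructor <;> rintro _ ⟨u, hu, rfl⟩ <;> rw [SetLike.mem_coe, hP] at hu <;> rw [hP]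
    · exact (totalDegree_mul p u).trans (by omega)
    · exact (totalDegree_mul g u).trans (by omega)
  have hker : finrank ℝ ↥(((P (N + l)).map (L p)) ⊔ ((P (N + k)).map (L g))) ≤
      finrank ℝ (LinearMap.ker (Ψ.domRestrict (P (N + k + l)))) := by
    rw [← (Submodule.comapSubtypeEquivOfLe hle).finrank_eq]
    refine Submodule.finrank_mono ?_
    rw [LinearMap.ker_domRestrict]
    refine Submodule.comap_mono ?_
    rw [sup_le_iff]
    constructor <;> rintro _ ⟨u, hu, rfl⟩
    · exact h1 u
    · exact h2 u
  have hinf : finrank ℝ ↥(((P (N + l)).map (L p)) ⊓ ((P (N + k)).map (L g))) ≤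
      finrank ℝ (P N) := by
    rw [← hLf (p * g) (mul_ne_zero hp hg) N]
    refine Submodule.finrank_mono ?_
    rintro _ ⟨⟨u, hu, rfl⟩, ⟨v, hv, huv⟩⟩
    simp only [L, LinearMap.mulLeft_apply] at huv
    have hgu : g ∣ u := h.symm.dvd_of_dvd_mul_left ⟨v, huv.symm⟩
    obtain ⟨w, rfl⟩ := hgu
    refine ⟨w, ?_, by simp [L]⟩
    rw [SetLike.mem_coe, hP] at hu ⊢
    by_cases hw : w = 0
    · simp [hw]
    rw [totalDegree_mul_of_isDomain hg hw] at hu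
    omega
  have e1 := LinearMap.finrank_range_add_finrank_ker (Ψ.domRestrict (P (N + k + l)))
  rw [LinearMap.range_eq_top.2 hsurj, finrank_top] at e1
  have e2 := Submodule.finrank_sup_add_finrank_inf_eq
    ((P (N + l)).map (L p)) ((P (N + k)).map (L g))
  rw [hLf p hp, hLf g hg] at e2
  have f1 := two_mul_finrank_restrictTotalDegree N
  have f2 := two_mul_finrank_restrictTotalDegree (N + k)
  have f3 := two_mul_finrank_restrictTotalDegree (N + l)
  have f4 := two_mul_finrank_restrictTotalDegree (N + k + l)
  simp only [P] at *
  nlinarith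

end Bezout

end NodalCount

namespace NodalCount

open Set

section Multiplicity

open MvPolynomial Module

theorem totalDegree_pderiv_le (i : Fin 2) (p : MvPolynomial (Fin 2) ℝ) :
    (pderiv i p).totalDegree ≤ p.totalDegree - 1 := by
  refine Finset.sup_le fun d hd => ?_
  rw [MvPolynomial.mem_support_iff, coeff_pderiv] at hd
  have := le_totalDegree (MvPolynomial.mem_support_iff.2 (left_ne_zero_of_mul hd))
  rw [sum_eq_add] at this ⊢
  fin_cases i <;> simp at this <;> omega

theorem isUnit_of_totalDegree_eq_zero {p : MvPolynomial (Fin 2) ℝ} (h0 : p ≠ 0)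
    (h : p.totalDegree = 0) : IsUnit p := by
  rw [totalDegree_eq_zero_iff_eq_C.1 h] at h0 ⊢
  exact (Ne.isUnit fun h => h0 (by rw [h, C_0])).map C

theorem isRelPrime_pderiv {p : MvPolynomial (Fin 2) ℝ} {k : ℕ} (hk : p.totalDegree ≤ k)
    (hc : p.coeff (Finsupp.single 1 k) ≠ 0) (hsq : Squarefree p) :
    IsRelPrime p (pderiv 1 p) := by
  have hp0 : p ≠ 0 := fun h => hc (by rw [h, coeff_zero])
  refine WfDvdMonoid.isRelPrime_of_no_irreducible_factors (fun h => hp0 h.1) ?_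
  rintro ϖ hϖ ⟨r, rfl⟩ hdvd
  have hr0 : r ≠ 0 := right_ne_zero_of_mul hp0
  have htd := totalDegree_mul_of_isDomain hϖ.ne_zero hr0
  have hdeg : ϖ.totalDegree ≠ 0 := fun h =>
    hϖ.not_isUnit (isUnit_of_totalDegree_eq_zero hϖ.ne_zero h)
  rw [pderiv_mul] at hdvd
  have hdvd' := (dvd_add_left (dvd_mul_right ϖ _)).1 hdvd
  rcases hϖ.prime.dvd_or_dvd hdvd' with hd | ⟨s, rfl⟩
  · have h0 : pderiv 1 ϖ = 0 := by
      by_contra hne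
      obtain ⟨s, hs⟩ := hd
      have h1 := totalDegree_pderiv_le 1 ϖ
      rw [hs, totalDegree_mul_of_isDomain hϖ.ne_zero
        (right_ne_zero_of_mul (hs ▸ hne))] at h1
      omega
    have h1 : (slice ϖ 0).natDegree = 0 := Polynomial.derivative_eq_zero.1 (by
      rw [derivative_slice, h0]; simp [slice])
    have h2 : slice (ϖ * r) 0 = slice ϖ 0 * slice r 0 := by simp [slice]
    have h3 : k ≤ (slice (ϖ * r) 0).natDegree :=
     Polynomial.le_natDegree_of_ne_zero (by rwa [coeff_slice _ _ hk])
    have h4 := Polynomial.natDegree_mul_le (p := slice ϖ 0) (q := slice r 0)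
    have h5 := natDegree_slice_le r 0
    rw [h2] at h3
    omega
  · exact hϖ.not_isUnit (hsq ϖ ⟨s, by ring⟩)

/-- The maximal ideal of polynomials vanishing at `z`. -/
noncomputable def maximalIdealAt (z : ℝ × ℝ) : Ideal (MvPolynomial (Fin 2) ℝ) :=
  RingHom.ker (MvPolynomial.eval ![z.1, z.2])

theorem mem_maximalIdealAt {z : ℝ × ℝ} {p : MvPolynomial (Fin 2) ℝ} :
    p ∈ maximalIdealAt z ↔ MvPolynomial.eval ![z.1, z.2] p = 0 := RingHom.mem_ker

theorem maximalIdealAt_isMaximal (z : ℝ × ℝ) : (maximalIdealAt z).IsMaximal :=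
  RingHom.ker_isMaximal_of_surjective _ fun a => ⟨C a, by simp⟩

theorem maximalIdealAt_injective : Function.Injective maximalIdealAt := by
  intro z z' h
  have h1 : X 0 - C z.1 ∈ maximalIdealAt z := by simp [mem_maximalIdealAt]
  have h2 : X 1 - C z.2 ∈ maximalIdealAt z := by simp [mem_maximalIdealAt]
  rw [h, mem_maximalIdealAt] at h1 h2
  simp [sub_eq_zero] at h1 h2
  exact Prod.ext h1.symm h2.symm

/-- Local linear conditions at finitely many points, all vanishing on an ideal generated by two
coprime polynomials, are bounded in number by the product of the degrees. -/
theorem sum_le_mul_totalDegree {p g : MvPolynomial (Fin 2) ℝ} (hp : p ≠ 0) (hg : g ≠ 0)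
    (h : IsRelPrime p g) (Z : Finset (ℝ × ℝ)) (w : ℝ × ℝ → ℕ)
    (hw : ∀ z ∈ Z, ∃ ψ : MvPolynomial (Fin 2) ℝ →ₗ[ℝ] (Fin (w z) → ℝ), Function.Surjective ψ ∧
      (∀ u, ψ (p * u) = 0) ∧ (∀ u, ψ (g * u) = 0) ∧ ∃ e, ∀ u ∈ maximalIdealAt z ^ e, ψ u = 0) :
    ∑ z ∈ Z, w z ≤ p.totalDegree * g.totalDegree := by
  choose ψ hsurj h1 h2 e he using fun z : Z => hw z z.2
  have hcop : Pairwise (Function.onFun IsCoprime fun z : Z => maximalIdealAt z.1 ^ e z) := by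
    intro z z' hne
    have := maximalIdealAt_isMaximal z.1
    have := maximalIdealAt_isMaximal z'.1
    exact (Ideal.isCoprime_of_isMaximal fun h =>
      hne (Subtype.ext (maximalIdealAt_injective h))).pow
  have key := finrank_le_mul_totalDegree hp hg h (LinearMap.pi ψ) (fun v => by
    choose u hu using fun z => hsurj z (v z)
    obtain ⟨r, hr⟩ := Ideal.exists_forall_sub_mem_ideal hcop u
    refine ⟨r, funext fun z => ?_⟩
    have := he z _ (hr z)
    rw [map_sub, sub_eq_zero, hu] at this
    exact this) (fun u => funext fun z => h1 z u) (fun u => funext fun z => h2 z u)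
  rw [finrank_pi_fintype] at key
  simp only [finrank_fin_fun] at key
  rwa [← Finset.sum_coe_sort]

/-- A local condition given by evaluation. -/
theorem exists_eval_functional {p g : MvPolynomial (Fin 2) ℝ} {z : ℝ × ℝ}
    (hp : MvPolynomial.eval ![z.1, z.2] p = 0) (hg : MvPolynomial.eval ![z.1, z.2] g = 0) :
    ∃ ψ : MvPolynomial (Fin 2) ℝ →ₗ[ℝ] (Fin 1 → ℝ), Function.Surjective ψ ∧
      (∀ u, ψ (p * u) = 0) ∧ (∀ u, ψ (g * u) = 0) ∧ ∃ e, ∀ u ∈ maximalIdealAt z ^ e, ψ u = 0 := by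
  refine ⟨LinearMap.pi fun _ => (MvPolynomial.aeval ![z.1, z.2]).toLinearMap, ?_, ?_, ?_, 1, ?_⟩
  · intro v
    refine ⟨C (v 0), funext fun i => ?_⟩
    rw [Subsingleton.elim i 0]
    simp
  · intro u
    ext i
    simp [aeval_eq_eval, hp]
  · intro u
    ext i
    simp [aeval_eq_eval, hg]
  · intro u hu
    rw [pow_one, mem_maximalIdealAt] at hu
    ext i
    simpa [aeval_eq_eval] using hu

theorem finite_common_zeros {p g : MvPolynomial (Fin 2) ℝ} (hp : p ≠ 0) (hg : g ≠ 0)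
    (h : IsRelPrime p g) : {z : ℝ × ℝ | MvPolynomial.eval ![z.1, z.2] p = 0 ∧
      MvPolynomial.eval ![z.1, z.2] g = 0}.Finite := by
  by_contra hinf
  obtain ⟨Z, hZ, hcard⟩ := Set.Infinite.exists_subset_card_eq hinf
    (p.totalDegree * g.totalDegree + 1)
  have := sum_le_mul_totalDegree hp hg h Z (fun _ => 1) fun z hz =>
    exists_eval_functional (hZ hz).1 (hZ hz).2
  simp at this
  omega

end Multiplicity

section Translate

open MvPolynomial Module

/-- The exponent of `x ^ i * y ^ j`. -/
noncomputable def expo (i j : ℕ) : Fin 2 →₀ ℕ := Finsupp.single 0 i + Finsupp.single 1 j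

@[simp] theorem expo_apply_zero (i j : ℕ) : expo i j 0 = i := by simp [expo]

@[simp] theorem expo_apply_one (i j : ℕ) : expo i j 1 = j := by simp [expo]

theorem expo_zero_left (j : ℕ) : expo 0 j = Finsupp.single 1 j := by simp [expo]

theorem expo_inj {i j i' j' : ℕ} : expo i j = expo i' j' ↔ i = i' ∧ j = j' :=
  ⟨fun h => ⟨by simpa using DFunLike.congr_fun h 0, by simpa using DFunLike.congr_fun h 1⟩,
    by rintro ⟨rfl, rfl⟩; rfl⟩

/-- Translation of polynomials, moving `z` to the origin. -/
noncomputable def translate (z : ℝ × ℝ) : MvPolynomial (Fin 2) ℝ →ₐ[ℝ] MvPolynomial (Fin 2) ℝ :=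
  aeval ![X 0 + C z.1, X 1 + C z.2]

theorem translate_neg_translate (z : ℝ × ℝ) (p : MvPolynomial (Fin 2) ℝ) :
    translate z (translate (-z) p) = p := by
  have : (translate z).comp (translate (-z)) = AlgHom.id ℝ _ := by
    refine MvPolynomial.algHom_ext fun i => ?_
    fin_cases i <;> simp [translate]
  exact DFunLike.congr_fun this p

theorem coeff_zero_translate (z : ℝ × ℝ) (p : MvPolynomial (Fin 2) ℝ) :
    (translate z p).coeff 0 = MvPolynomial.eval ![z.1, z.2] p := by
  rw [← constantCoeff_eq]
  induction p using MvPolynomial.induction_on with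
  | C a => simp [translate]
  | add p q hp hq => simp [hp, hq]
  | mul_X p i hp => fin_cases i <;> simp [hp] <;> simp [translate]

theorem pderiv_translate (z : ℝ × ℝ) (i : Fin 2) (p : MvPolynomial (Fin 2) ℝ) :
    pderiv i (translate z p) = translate z (pderiv i p) := by
  induction p using MvPolynomial.induction_on with
  | C a => simp [translate]
  | add p q hp hq => simp [hp, hq]
  | mul_X p j hp =>
    rw [map_mul, pderiv_mul, pderiv_mul, hp, map_add, map_mul, map_mul]
    fin_cases i <;> fin_cases j <;> simp [translate, pderiv_X]

theorem coeff_iterate_pderiv_ne_zero {p : MvPolynomial (Fin 2) ℝ} {m j : ℕ}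
    (h : p.coeff (Finsupp.single 1 (j + m)) ≠ 0) :
    ((pderiv 1)^[m] p).coeff (Finsupp.single 1 j) ≠ 0 := by
  induction m generalizing j with
  | zero => simpa using h
  | succ m ih =>
    rw [Function.iterate_succ_apply', coeff_pderiv, ← Finsupp.single_add]
    refine mul_ne_zero (ih ?_) (by positivity)
    rwa [add_right_comm, add_assoc]

theorem iterate_pderiv_translate (z : ℝ × ℝ) (p : MvPolynomial (Fin 2) ℝ) (m : ℕ) :
    (pderiv 1)^[m] (translate z p) = translate z ((pderiv 1)^[m] p) := by
  induction m with
  | zero => rfl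
  | succ m ih => rw [Function.iterate_succ_apply', Function.iterate_succ_apply', ih,
      pderiv_translate]

/-- The multiplicity of `p` at `z` is `m`, and the vertical line through `z` is not tangent to the
zero set. -/
def Nice (p : MvPolynomial (Fin 2) ℝ) (z : ℝ × ℝ) (m : ℕ) : Prop :=
  (∀ d : Fin 2 →₀ ℕ, d 0 + d 1 < m → (translate z p).coeff d = 0) ∧
    (translate z p).coeff (Finsupp.single 1 m) ≠ 0

theorem Nice.iterate_derivative_ne_zero {p : MvPolynomial (Fin 2) ℝ} {z : ℝ × ℝ} {m : ℕ}
    (h : Nice p z m) : (Polynomial.derivative^[m] (slice p z.1)).eval z.2 ≠ 0 := by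
  rw [iterate_derivative_slice, eval_slice, ← coeff_zero_translate, ← iterate_pderiv_translate]
  have := coeff_iterate_pderiv_ne_zero (p := translate z p) (m := m) (j := 0)
    (by rw [zero_add]; exact h.2)
  simpa using this

theorem coeff_mul_of_low {F U : MvPolynomial (Fin 2) ℝ} {s : ℕ}
    (hF : ∀ d : Fin 2 →₀ ℕ, d 0 + d 1 < s → F.coeff d = 0) {d : Fin 2 →₀ ℕ}
    (hd : d 0 + d 1 ≤ s) : (F * U).coeff d = F.coeff d * U.coeff 0 := by
  classical
  rw [coeff_mul, Finset.sum_eq_single (d, 0)]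
  · rintro ⟨a, b⟩ hab hne
    rw [Finset.HasAntidiagonal.mem_antidiagonal] at hab
    simp only at hab
    rw [hF a, zero_mul]
    by_contra hcon
    subst hab
    simp only [Finsupp.add_apply] at hd
    have : b = 0 := by
      ext i
      fin_cases i <;> simp <;> omega
    subst this
    simp at hne
  · intro h
    simp at h

theorem translate_mem_pow {z : ℝ × ℝ} {u : MvPolynomial (Fin 2) ℝ} {e : ℕ}
    (hu : u ∈ maximalIdealAt z ^ e) {d : Fin 2 →₀ ℕ} (hd : d 0 + d 1 < e) :
    (translate z u).coeff d = 0 := by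
  have h1 : (maximalIdealAt z).map (translate z) ≤ idealOfVars (Fin 2) ℝ ^ 1 := by
    rw [Ideal.map_le_iff_le_comap]
    intro v hv
    rw [Ideal.mem_comap, mem_pow_idealOfVars_iff']
    intro d hd
    have : d = 0 := (Finsupp.degree_eq_zero_iff d).1 (by simpa using hd)
    rw [this, coeff_zero_translate, ← mem_maximalIdealAt]
    exact hv
  have h2 : translate z u ∈ idealOfVars (Fin 2) ℝ ^ e := by
    have := Ideal.mem_map_of_mem (translate z) hu
    rw [Ideal.map_pow] at this
    have h3 := Ideal.pow_right_mono h1 e this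
    rwa [pow_one] at h3
  refine (mem_pow_idealOfVars_iff' _ _).1 h2 d ?_
  rw [Finsupp.degree_eq_sum, Fin.sum_univ_two]
  exact hd

/-- At a point where the zero set of `p` has multiplicity `m` and no vertical tangent, the ideal
generated by `p` and its vertical derivative satisfies `2 * (m - 1)` linear conditions. -/
theorem Nice.exists_functional {p : MvPolynomial (Fin 2) ℝ} {z : ℝ × ℝ} {m : ℕ}
    (h : Nice p z m) :
    ∃ ψ : MvPolynomial (Fin 2) ℝ →ₗ[ℝ] (Fin (2 * (m - 1)) → ℝ), Function.Surjective ψ ∧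
      (∀ u, ψ (p * u) = 0) ∧ (∀ u, ψ (pderiv 1 p * u) = 0) ∧
      ∃ e, ∀ u ∈ maximalIdealAt z ^ e, ψ u = 0 := by
  set P := translate z p with hP
  set G := pderiv 1 P with hG
  have hGt : translate z (pderiv 1 p) = G := (pderiv_translate _ _ _).symm
  have hGlow : ∀ d : Fin 2 →₀ ℕ, d 0 + d 1 < m - 1 → G.coeff d = 0 := by
    intro d hd
    rw [hG, coeff_pderiv, h.1, zero_mul]
    simp; omega
  have hGtop : 2 ≤ m → G.coeff (expo 0 (m - 1)) ≠ 0 := by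
    intro hm
    rw [hG, coeff_pderiv, expo_zero_left, ← Finsupp.single_add, Nat.sub_add_cancel (by omega)]
    exact mul_ne_zero h.2 (by positivity)
  let κ : ℕ → ℝ := fun j => if j + 2 = m then G.coeff (expo 1 j) / G.coeff (expo 0 (m - 1)) else 0
  let φ : Fin 2 × Fin (m - 1) → MvPolynomial (Fin 2) ℝ →ₗ[ℝ] ℝ := fun ij =>
    (lcoeff ℝ (expo ij.1 ij.2) - (ij.1 * κ ij.2 : ℝ) • lcoeff ℝ (expo 0 (m - 1))) ∘ₗ
      (translate z).toLinearMap
  have hφ : ∀ ij u, φ ij u = (translate z u).coeff (expo ij.1 ij.2) -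
      ij.1 * κ ij.2 * (translate z u).coeff (expo 0 (m - 1)) := fun ij u => rfl
  have hbound : ∀ ij : Fin 2 × Fin (m - 1), ij.1.val + ij.2.val ≤ m - 1 ∧ 2 ≤ m := by
    rintro ⟨i, j⟩
    have := i.2
    have := j.2
    simp only
    omega
  suffices hψ : Function.Surjective (LinearMap.pi φ) ∧ (∀ u, LinearMap.pi φ (p * u) = 0) ∧
      (∀ u, LinearMap.pi φ (pderiv 1 p * u) = 0) ∧
      ∃ e, ∀ u ∈ maximalIdealAt z ^ e, LinearMap.pi φ u = 0 by
    obtain ⟨h1, h2, h3, e, h4⟩ := hψ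
    let E := LinearEquiv.funCongrLeft ℝ ℝ (finProdFinEquiv (m := 2) (n := m - 1)).symm
    refine ⟨E.toLinearMap ∘ₗ LinearMap.pi φ, E.surjective.comp h1, fun u => ?_, fun u => ?_,
      e, fun u hu => ?_⟩
    · rw [LinearMap.comp_apply, h2, map_zero]
    · rw [LinearMap.comp_apply, h3, map_zero]
    · rw [LinearMap.comp_apply, h4 u hu, map_zero]
  refine ⟨fun v => ?_, fun u => funext fun ij => ?_, fun u => funext fun ij => ?_,
    m, fun u hu => funext fun ij => ?_⟩
  · refine ⟨translate (-z) (∑ ij : Fin 2 × Fin (m - 1),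
      monomial (expo ij.1 ij.2) (v ij)), funext fun ij => ?_⟩
    rw [LinearMap.pi_apply, hφ, translate_neg_translate, coeff_sum, coeff_sum,
      Finset.sum_eq_single ij, Finset.sum_eq_zero]
    · simp
    · rintro ⟨i, j⟩ -
      rw [coeff_monomial, if_neg]
      rw [expo_inj]
      have := j.2
      simp only
      omega
    · rintro ⟨i, j⟩ - hne
      rw [coeff_monomial, if_neg]
      rw [expo_inj]
      rintro ⟨h1, h2⟩
      exact hne (Prod.ext (Fin.ext h1) (Fin.ext h2))
    · simp
  · obtain ⟨hb, hm⟩ := hbound ij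
    rw [LinearMap.pi_apply, hφ, map_mul, ← hP, coeff_mul_of_low h.1 (by simp; omega),
      coeff_mul_of_low h.1 (by simp), h.1 _ (by simp; omega), h.1 _ (by simp; omega)]
    simp
  · obtain ⟨hb, hm⟩ := hbound ij
    rw [LinearMap.pi_apply, hφ, map_mul, hGt, coeff_mul_of_low hGlow (by simpa using hb),
      coeff_mul_of_low hGlow (by simp)]
    have := hGtop hm
    obtain ⟨i, j⟩ := ij
    simp only at hb
    by_cases hj : i.val = 1 ∧ j.val + 2 = m
    · simp only [κ, hj.1, hj.2, if_true, Pi.zero_apply]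
      field_simp
      simp
    · have h0 : (i.val : ℝ) * κ j = 0 := by
        by_cases hj' : j.val + 2 = m
        · have : i.val = 0 := by omega
          simp [this]
        · simp [κ, hj']
      simp only [h0]
      rw [hGlow _ (by simp; omega)]
      simp
  · obtain ⟨hb, hm⟩ := hbound ij
    rw [LinearMap.pi_apply, hφ, translate_mem_pow hu (by simp; omega),
      translate_mem_pow hu (by simp; omega)]
    simp

/-- The number of components of the complement of the zero set of a squarefree polynomial in
general position. -/
theorem two_mul_card_le_of_nice {p : MvPolynomial (Fin 2) ℝ} {k : ℕ} (hk : p.totalDegree ≤ k)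
    (hc : p.coeff (Finsupp.single 1 k) ≠ 0) (hsq : Squarefree p)
    (hnice : ∀ z : ℝ × ℝ, MvPolynomial.eval ![z.1, z.2] p = 0 →
      MvPolynomial.eval ![z.1, z.2] (pderiv 0 p) = 0 →
      MvPolynomial.eval ![z.1, z.2] (pderiv 1 p) = 0 → ∃ m, Nice p z m)
    {T : Finset (ℝ × ℝ)} (hT : Separated (region (slice p) univ) T) :
    2 * T.card ≤ 2 * (k + 1) + k * (k - 1) := by
  classical
  have hq := sliceFamily_slice hk hc
  have hp0 : p ≠ 0 := fun h => hc (by rw [h, coeff_zero])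
  have hcrit : criticalSet (slice p) = {z : ℝ × ℝ | MvPolynomial.eval ![z.1, z.2] p = 0 ∧
      MvPolynomial.eval ![z.1, z.2] (pderiv 1 p) = 0} := by
    simp only [criticalSet, derivative_slice, eval_slice]
  rcases Nat.eq_zero_or_pos k with rfl | hk0
  · have := hq.two_mul_card_le ∅ (by
      rw [hcrit, Finset.coe_empty, eq_empty_iff_forall_notMem]
      rintro z ⟨hz, -⟩
      rw [totalDegree_eq_zero_iff_eq_C.1 (Nat.le_zero.1 hk), eval_C] at hz
      rw [Finsupp.single_zero] at hc
      exact hc hz) (fun _ => 0) (by simp) hT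
    simpa using this
  have hg0 : pderiv 1 p ≠ 0 := fun h => by
    have h1 : (pderiv 1 p).coeff (Finsupp.single 1 (k - 1)) ≠ 0 := by
      rw [coeff_pderiv, ← Finsupp.single_add, Nat.sub_add_cancel hk0]
      exact mul_ne_zero hc (by positivity)
    rw [h, coeff_zero] at h1
    exact h1 rfl
  have hrel := isRelPrime_pderiv hk hc hsq
  have hfin := finite_common_zeros hp0 hg0 hrel
  have hm : ∀ z : ℝ × ℝ, ∃ m, (MvPolynomial.eval ![z.1, z.2] p = 0 ∧
      MvPolynomial.eval ![z.1, z.2] (pderiv 0 p) = 0 ∧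
      MvPolynomial.eval ![z.1, z.2] (pderiv 1 p) = 0) → Nice p z m := by
    intro z
    by_cases h : MvPolynomial.eval ![z.1, z.2] p = 0 ∧
      MvPolynomial.eval ![z.1, z.2] (pderiv 0 p) = 0 ∧
      MvPolynomial.eval ![z.1, z.2] (pderiv 1 p) = 0
    · obtain ⟨m, hm⟩ := hnice z h.1 h.2.1 h.2.2
      exact ⟨m, fun _ => hm⟩
    · exact ⟨0, fun h' => absurd h' h⟩
  choose m hm using hm
  let w : ℝ × ℝ → ℕ := fun z =>
    if MvPolynomial.eval ![z.1, z.2] (pderiv 0 p) = 0 then 2 * (m z - 1) else 1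
  have hsum : ∑ z ∈ hfin.toFinset, w z ≤ p.totalDegree * (pderiv 1 p).totalDegree := by
    refine sum_le_mul_totalDegree hp0 hg0 hrel _ w fun z hz => ?_
    obtain ⟨h1, h2⟩ := hfin.mem_toFinset.1 hz
    by_cases h0 : MvPolynomial.eval ![z.1, z.2] (pderiv 0 p) = 0
    · rw [show w z = 2 * (m z - 1) from if_pos h0]
      exact (hm z ⟨h1, h0, h2⟩).exists_functional
    · rw [show w z = 1 from if_neg h0]
      exact exists_eval_functional h1 h2
  have hmain := hq.two_mul_card_le hfin.toFinset (by rw [hfin.coe_toFinset, hcrit]) w (by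
    intro z hz
    obtain ⟨h1, h2⟩ := hfin.mem_toFinset.1 hz
    by_cases h0 : MvPolynomial.eval ![z.1, z.2] (pderiv 0 p) = 0
    · exact Or.inl ⟨m z, if_pos h0, (hm z ⟨h1, h0, h2⟩).iterate_derivative_ne_zero⟩
    · refine Or.inr ⟨if_neg h0, ?_⟩
      rcases lt_or_gt_of_ne h0 with hlt | hgt
      · right
        rw [← slice_neg]
        exact increasingAt_slice (by simpa using h1) (by simpa using hlt)
      · exact Or.inl (increasingAt_slice h1 hgt)) hT
  have h3 : p.totalDegree * (pderiv 1 p).totalDegree ≤ k * (k - 1) :=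
    Nat.mul_le_mul hk ((totalDegree_pderiv_le 1 p).trans (Nat.sub_le_sub_right hk 1))
  omega

end Translate

section Shear

open MvPolynomial

/-- The linear change of variables `x ↦ x + c * y`. -/
noncomputable def shear (c : ℝ) : MvPolynomial (Fin 2) ℝ →ₐ[ℝ] MvPolynomial (Fin 2) ℝ :=
  aeval ![X 0 + C c * X 1, X 1]

/-- The linear homeomorphism of the plane underlying `shear c`. -/
def shearHomeomorph (c : ℝ) : ℝ × ℝ ≃ₜ ℝ × ℝ where
  toFun z := (z.1 + c * z.2, z.2)
  invFun z := (z.1 - c * z.2, z.2)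
  left_inv z := by simp
  right_inv z := by simp
  continuous_toFun := by fun_prop
  continuous_invFun := by fun_prop

theorem shearHomeomorph_apply (c : ℝ) (z : ℝ × ℝ) :
    shearHomeomorph c z = (z.1 + c * z.2, z.2) := rfl

theorem eval_shear (c x y : ℝ) (p : MvPolynomial (Fin 2) ℝ) :
    MvPolynomial.eval ![x, y] (shear c p) = MvPolynomial.eval ![x + c * y, y] p := by
  induction p using MvPolynomial.induction_on with
  | C a => simp [shear]
  | add p q hp hq => simp [hp, hq]
  | mul_X p i hp => fin_cases i <;> simp [hp] <;> simp [shear]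

theorem shear_shear_neg (c : ℝ) (p : MvPolynomial (Fin 2) ℝ) : shear c (shear (-c) p) = p := by
  have : (shear c).comp (shear (-c)) = AlgHom.id ℝ _ := by
    refine MvPolynomial.algHom_ext fun i => ?_
    fin_cases i <;> simp [shear]
  exact DFunLike.congr_fun this p

theorem shear_neg_shear (c : ℝ) (p : MvPolynomial (Fin 2) ℝ) : shear (-c) (shear c p) = p := by
  simpa using shear_shear_neg (-c) p

theorem squarefree_shear {p : MvPolynomial (Fin 2) ℝ} (hp : Squarefree p) (c : ℝ) :
    Squarefree (shear c p) := by
  intro a ha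
  have h1 : shear (-c) a * shear (-c) a ∣ p := by
    have := map_dvd (shear (-c)) ha
    rwa [map_mul, shear_neg_shear] at this
  have := (hp _ h1).map (shear c)
  rwa [shear_shear_neg] at this

theorem totalDegree_shear_le (c : ℝ) (p : MvPolynomial (Fin 2) ℝ) :
    (shear c p).totalDegree ≤ p.totalDegree := by
  rw [shear, aeval_def, eval₂_eq']
  refine totalDegree_finsetSum_le fun d hd => ?_
  refine (totalDegree_mul _ _).trans ?_
  rw [algebraMap_eq, totalDegree_C, zero_add, Fin.prod_univ_two]
  have h0 : (X 0 + C c * X 1 : MvPolynomial (Fin 2) ℝ).totalDegree ≤ 1 := by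
    refine (totalDegree_add _ _).trans (max_le (totalDegree_X _).le ?_)
    refine (totalDegree_mul _ _).trans ?_
    simp
  have h1 := le_totalDegree hd
  rw [sum_eq_add] at h1
  refine (totalDegree_mul _ _).trans (le_trans (add_le_add ?_ ?_) h1)
  · refine (totalDegree_pow _ _).trans ?_
    calc d 0 * _ ≤ d 0 * 1 := Nat.mul_le_mul_left _ h0
      _ = d 0 := mul_one _
  · simp

theorem pderiv_zero_shear (c : ℝ) (p : MvPolynomial (Fin 2) ℝ) :
    pderiv 0 (shear c p) = shear c (pderiv 0 p) := by
  induction p using MvPolynomial.induction_on with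
  | C a => simp [shear]
  | add p q hp hq => simp [hp, hq]
  | mul_X p j hp =>
    rw [map_mul, pderiv_mul, pderiv_mul, hp, map_add, map_mul, map_mul]
    fin_cases j <;> simp [shear, pderiv_X]

theorem pderiv_one_shear (c : ℝ) (p : MvPolynomial (Fin 2) ℝ) :
    pderiv 1 (shear c p) = shear c (pderiv 1 p + C c * pderiv 0 p) := by
  induction p using MvPolynomial.induction_on with
  | C a => simp [shear]
  | add p q hp hq => simp [hp, hq]; ring
  | mul_X p j hp =>
    rw [map_mul, pderiv_mul, pderiv_mul, pderiv_mul, hp]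
    simp only [map_add, map_mul]
    fin_cases j <;> simp [shear, pderiv_X] <;> ring

theorem translate_shear (c : ℝ) (z : ℝ × ℝ) (p : MvPolynomial (Fin 2) ℝ) :
    translate z (shear c p) = shear c (translate (shearHomeomorph c z) p) := by
  have : (translate z).comp (shear c) = (shear c).comp (translate (shearHomeomorph c z)) := by
    refine MvPolynomial.algHom_ext fun i => ?_
    fin_cases i
    · simp [shear, translate, shearHomeomorph_apply]
      ring
    · simp [shear, translate, shearHomeomorph_apply]
  exact DFunLike.congr_fun this p

theorem shear_low {F : MvPolynomial (Fin 2) ℝ} {m : ℕ} (c : ℝ)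
    (hF : ∀ d : Fin 2 →₀ ℕ, d 0 + d 1 < m → F.coeff d = 0) {d : Fin 2 →₀ ℕ}
    (hd : d 0 + d 1 < m) : (shear c F).coeff d = 0 := by
  have hdeg : ∀ d : Fin 2 →₀ ℕ, d.degree = d 0 + d 1 := fun d => by
    rw [Finsupp.degree_eq_sum, Fin.sum_univ_two]
  have h1 : (idealOfVars (Fin 2) ℝ).map (shear c) ≤ idealOfVars (Fin 2) ℝ := by
    rw [Ideal.map_le_iff_le_comap, idealOfVars, Ideal.span_le]
    have hX : ∀ i, (X i : MvPolynomial (Fin 2) ℝ) ∈ Ideal.span (Set.range X) :=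
      fun i => Ideal.subset_span ⟨i, rfl⟩
    rintro _ ⟨i, rfl⟩
    rw [SetLike.mem_coe, Ideal.mem_comap]
    fin_cases i
    · simpa [shear] using Ideal.add_mem _ (hX 0) (Ideal.mul_mem_left _ (C c) (hX 1))
    · simpa [shear] using hX 1
  have h2 : F ∈ idealOfVars (Fin 2) ℝ ^ m :=
    (mem_pow_idealOfVars_iff' _ _).2 fun d hd => hF d (by rwa [← hdeg])
  have h3 := Ideal.mem_map_of_mem (shear c) h2
  rw [Ideal.map_pow] at h3
  exact (mem_pow_idealOfVars_iff' _ _).1 (Ideal.pow_right_mono h1 m h3) d (by rwa [hdeg])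

/-- The dehomogenization of the homogeneous component of degree `m`. -/
noncomputable def form (m : ℕ) (F : MvPolynomial (Fin 2) ℝ) : Polynomial ℝ :=
  ∑ d ∈ F.support with d 0 + d 1 = m, Polynomial.monomial (d 0) (F.coeff d)

theorem form_ne_zero {F : MvPolynomial (Fin 2) ℝ} {m : ℕ} {d : Fin 2 →₀ ℕ}
    (hd : F.coeff d ≠ 0) (hm : d 0 + d 1 = m) : form m F ≠ 0 := by
  intro h
  have h1 : (form m F).coeff (d 0) = F.coeff d := by
    rw [form, Polynomial.finsetSum_coeff, Finset.sum_eq_single d]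
    · simp
    · intro e he hne
      rw [Polynomial.coeff_monomial, if_neg]
      intro h0
      refine hne (Finsupp.ext fun i => ?_)
      have := (Finset.mem_filter.1 he).2
      fin_cases i
      · exact h0
      · simp; omega
    · intro hn
      simpa [hm] using hn
  rw [h, Polynomial.coeff_zero] at h1
  exact hd h1.symm

theorem coeff_slice_zero (p : MvPolynomial (Fin 2) ℝ) (m : ℕ) :
    (slice p 0).coeff m = p.coeff (Finsupp.single 1 m) := by
  rw [slice, aeval_def, eval₂_eq', Polynomial.finsetSum_coeff,
    Finset.sum_eq_single (Finsupp.single 1 m)]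
  · simp
  · intro d hd hne
    simp only [Fin.prod_univ_two, Matrix.cons_val_zero, Matrix.cons_val_one,
      Polynomial.algebraMap_eq]
    rw [← Polynomial.C_pow, ← mul_assoc, ← Polynomial.C_mul, Polynomial.coeff_C_mul,
      Polynomial.coeff_X_pow]
    by_cases h0 : d 0 = 0
    · rw [if_neg, mul_zero]
      rintro rfl
      refine hne (Finsupp.ext fun i => ?_)
      fin_cases i <;> simp [h0]
    · simp [h0]
  · intro h
    simp [MvPolynomial.notMem_support_iff.1 h]

theorem coeff_single_shear (c : ℝ) (F : MvPolynomial (Fin 2) ℝ) (m : ℕ) :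
    (shear c F).coeff (Finsupp.single 1 m) = (form m F).eval c := by
  have h1 : slice (shear c F) 0 =
      aeval ![Polynomial.C c * Polynomial.X, Polynomial.X] F := by
    have : (aeval ![Polynomial.C 0, Polynomial.X]).comp (shear c) =
        aeval ![Polynomial.C c * Polynomial.X, Polynomial.X] := by
      refine MvPolynomial.algHom_ext fun i => ?_
      fin_cases i <;> simp [shear]
    exact DFunLike.congr_fun this F
  rw [← coeff_slice_zero, h1, aeval_def, eval₂_eq', Polynomial.finsetSum_coeff, form,
    Polynomial.eval_finsetSum, Finset.sum_filter]
  refine Finset.sum_congr rfl fun d _ => ?_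
  simp only [Fin.prod_univ_two, Matrix.cons_val_zero, Matrix.cons_val_one,
    Polynomial.algebraMap_eq]
  rw [mul_pow, mul_assoc, ← pow_add, ← Polynomial.C_pow, ← mul_assoc, ← Polynomial.C_mul,
    Polynomial.coeff_C_mul, Polynomial.coeff_X_pow, Polynomial.eval_monomial]
  simp only [eq_comm (a := m), mul_ite, mul_one, mul_zero]

theorem exists_form_ne_zero {F : MvPolynomial (Fin 2) ℝ} (hF : F ≠ 0) :
    ∃ m, (∀ d : Fin 2 →₀ ℕ, d 0 + d 1 < m → F.coeff d = 0) ∧ form m F ≠ 0 := by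
  classical
  have hex : ∃ m, ∃ d : Fin 2 →₀ ℕ, d 0 + d 1 = m ∧ F.coeff d ≠ 0 := by
    obtain ⟨d, hd⟩ := MvPolynomial.ne_zero_iff.1 hF
    exact ⟨_, d, rfl, hd⟩
  refine ⟨Nat.find hex, fun d hd => ?_, ?_⟩
  · by_contra hne
    exact Nat.find_min hex hd ⟨d, rfl, hne⟩
  · obtain ⟨d, hd, hne⟩ := Nat.find_spec hex
    exact form_ne_zero hne hd

theorem form_totalDegree_ne_zero {F : MvPolynomial (Fin 2) ℝ} (hF : F ≠ 0) :
    form F.totalDegree F ≠ 0 := by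
  obtain ⟨d, hd, h⟩ := Finset.exists_mem_eq_sup F.support (by simpa using hF)
    fun d => d.sum fun _ e => e
  rw [sum_eq_add] at h
  exact form_ne_zero (MvPolynomial.mem_support_iff.1 hd) h.symm

theorem exists_eval_ne_zero {P : Polynomial ℝ} (hP : P ≠ 0) : ∃ c, P.eval c ≠ 0 := by
  by_contra h
  push Not at h
  exact hP (Polynomial.funext fun c => by rw [h c, Polynomial.eval_zero])

/-- Some shear of a squarefree polynomial is in general position. -/
theorem exists_shear_nice {p : MvPolynomial (Fin 2) ℝ} (hsq : Squarefree p) {k : ℕ}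
    (hk : p.totalDegree ≤ k) (hc : p.coeff (Finsupp.single 1 k) ≠ 0) :
    ∃ c : ℝ, (shear c p).coeff (Finsupp.single 1 k) ≠ 0 ∧
      ∀ z : ℝ × ℝ, MvPolynomial.eval ![z.1, z.2] (shear c p) = 0 →
      MvPolynomial.eval ![z.1, z.2] (pderiv 0 (shear c p)) = 0 →
      MvPolynomial.eval ![z.1, z.2] (pderiv 1 (shear c p)) = 0 → ∃ m, Nice (shear c p) z m := by
  classical
  have hp0 : p ≠ 0 := fun h => hc (by rw [h, coeff_zero])
  have hfin : {z : ℝ × ℝ | MvPolynomial.eval ![z.1, z.2] p = 0 ∧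
      MvPolynomial.eval ![z.1, z.2] (pderiv 1 p) = 0}.Finite := by
    by_cases hg0 : pderiv 1 p = 0
    · have hrel := isRelPrime_pderiv hk hc hsq
      rw [hg0, isRelPrime_zero_right] at hrel
      convert Set.finite_empty (α := ℝ × ℝ)
      rw [eq_empty_iff_forall_notMem]
      rintro z ⟨hz, -⟩
      exact (hrel.map (MvPolynomial.eval ![z.1, z.2])).ne_zero hz
    · exact finite_common_zeros hp0 hg0 (isRelPrime_pderiv hk hc hsq)
  have hinj : ∀ z, translate z p ≠ 0 := fun z h => hp0 (by
    have := translate_neg_translate (-z) p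
    rwa [neg_neg, h, map_zero, eq_comm] at this)
  choose m hlow hform using fun z => exists_form_ne_zero (hinj z)
  obtain ⟨c, hcne⟩ := exists_eval_ne_zero (P := form k p *
    ∏ z ∈ hfin.toFinset, form (m z) (translate z p)) (mul_ne_zero
      (form_ne_zero hc (by simp)) (Finset.prod_ne_zero_iff.2 fun z _ => hform z))
  rw [Polynomial.eval_mul, Polynomial.eval_prod, mul_ne_zero_iff, Finset.prod_ne_zero_iff] at hcne
  refine ⟨c, by rw [coeff_single_shear]; exact hcne.1, fun z h h0 h1 => ?_⟩
  have h2 : shearHomeomorph c z ∈ hfin.toFinset := by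
    rw [hfin.mem_toFinset]
    rw [eval_shear] at h
    rw [pderiv_zero_shear, eval_shear] at h0
    rw [pderiv_one_shear, eval_shear, map_add, map_mul, h0, mul_zero, add_zero] at h1
    exact ⟨h, h1⟩
  refine ⟨m (shearHomeomorph c z), fun d hd => ?_, ?_⟩
  · rw [translate_shear]
    exact shear_low c (hlow _) hd
  · rw [translate_shear, coeff_single_shear]
    exact hcne.2 _ h2

theorem image_region_shear (c : ℝ) (p : MvPolynomial (Fin 2) ℝ) :
    (shearHomeomorph c).symm '' region (slice p) univ = region (slice (shear c p)) univ := by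
  rw [Homeomorph.image_symm]
  ext z
  simp [region, eval_slice, eval_shear, shearHomeomorph_apply]

theorem card_le_of_shear {c : ℝ} {p : MvPolynomial (Fin 2) ℝ} {n : ℕ}
    (h : ∀ T, Separated (region (slice (shear c p)) univ) T → T.card ≤ n) {T : Finset (ℝ × ℝ)}
    (hT : Separated (region (slice p) univ) T) : T.card ≤ n := by
  have := hT.image (shearHomeomorph c).symm
  rw [image_region_shear] at this
  simpa using h _ this

theorem card_le_of_squarefree {p : MvPolynomial (Fin 2) ℝ} (hsq : Squarefree p)
    {T : Finset (ℝ × ℝ)} (hT : Separated (region (slice p) univ) T) :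
    T.card ≤ p.totalDegree * (p.totalDegree + 1) / 2 + 1 := by
  obtain ⟨c, hc⟩ := exists_eval_ne_zero (form_totalDegree_ne_zero hsq.ne_zero)
  rw [← coeff_single_shear] at hc
  obtain ⟨c', hc', hnice⟩ := exists_shear_nice (squarefree_shear hsq c)
    (totalDegree_shear_le c p) hc
  refine card_le_of_shear (c := c) (fun T hT => card_le_of_shear (c := c') (fun T hT => ?_) hT) hT
  have := two_mul_card_le_of_nice
    ((totalDegree_shear_le c' _).trans (totalDegree_shear_le c p)) hc'
    (squarefree_shear (squarefree_shear hsq c) c') hnice hT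
  generalize p.totalDegree = k at this
  cases k with
  | zero => omega
  | succ k =>
    rw [Nat.add_sub_cancel] at this
    have h1 : (k + 1) * (k + 1 + 1) = (k + 1) * k + 2 * (k + 1) := by ring
    omega

/-- The complement of the zero set of a nonzero bivariate polynomial of degree `k` has at most
`k * (k + 1) / 2 + 1` components. -/
theorem card_le_totalDegree {k : ℕ} {p : MvPolynomial (Fin 2) ℝ} (hp : p ≠ 0)
    (hk : p.totalDegree ≤ k) {T : Finset (ℝ × ℝ)}
    (hT : Separated (region (slice p) univ) T) : T.card ≤ k * (k + 1) / 2 + 1 := by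
  induction k using Nat.strong_induction_on generalizing p with
  | _ k ih =>
  by_cases hsq : Squarefree p
  · have := card_le_of_squarefree hsq hT
    have h2 : p.totalDegree * (p.totalDegree + 1) ≤ k * (k + 1) :=
      Nat.mul_le_mul hk (Nat.succ_le_succ hk)
    omega
  · simp only [Squarefree, not_forall] at hsq
    obtain ⟨a, ⟨b, rfl⟩, ha⟩ := hsq
    have hab : a * b ≠ 0 := fun h => hp (by rw [mul_assoc, h, mul_zero])
    have ha0 : a ≠ 0 := left_ne_zero_of_mul hab
    have hdeg : a.totalDegree ≠ 0 := fun h => ha (isUnit_of_totalDegree_eq_zero ha0 h)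
    rw [mul_assoc, totalDegree_mul_of_isDomain ha0 hab] at hk
    have hreg : region (slice (a * a * b)) univ = region (slice (a * b)) univ := by
      ext z
      simp [region, eval_slice]
    rw [hreg] at hT
    have := ih (k - 1) (by omega) hab (by omega) hT
    have h2 : (k - 1) * (k - 1 + 1) ≤ k * (k + 1) := Nat.mul_le_mul (by omega) (by omega)
    omega

end Shear

section Components

theorem natCard_connectedComponents_le {F : Set (ℝ × ℝ)} {n : ℕ}
    (h : ∀ T, Separated F T → T.card ≤ n) : Nat.card (ConnectedComponents F) ≤ n := by
  classical
  rcases finite_or_infinite (ConnectedComponents F) with hfin | hinf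
  · have := Fintype.ofFinite (ConnectedComponents F)
    let r : ConnectedComponents F → ℝ × ℝ := fun C => (ConnectedComponents.surjective_coe C).choose
    have hr : ∀ C, ∃ hC : r C ∈ F, (ConnectedComponents.mk (⟨r C, hC⟩ : F)) = C := fun C =>
      ⟨Subtype.prop _, (ConnectedComponents.surjective_coe C).choose_spec⟩
    choose hrF hrC using hr
    have hinj : Function.Injective r := by
      intro C C' hCC
      rw [← hrC C, ← hrC C']
      simp only [hCC]
    have := h (Finset.univ.image r) ⟨by simpa using hrF, by
      simp only [Finset.mem_image, Finset.mem_univ, true_and]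
      rintro _ ⟨C, rfl⟩ _ ⟨C', rfl⟩ u hu hu'
      have h1 : r C' ∈ connectedComponentIn F (r C) := by
        rw [connectedComponentIn_eq hu, ← connectedComponentIn_eq hu']
        exact mem_connectedComponentIn (hrF C')
      rw [connectedComponentIn_eq_image (hrF C)] at h1
      obtain ⟨v, hv, hv'⟩ := h1
      have h2 : v = ⟨r C', hrF C'⟩ := Subtype.ext hv'
      rw [h2, ← ConnectedComponents.coe_eq_coe', hrC, hrC] at hv
      rw [hv]⟩
    rwa [Finset.card_image_of_injective _ hinj, Finset.card_univ, ← Nat.card_eq_fintype_card]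
      at this
  · rw [Nat.card_eq_zero_of_infinite]
    exact Nat.zero_le _

end Components

section Hermite

open MvPolynomial

theorem totalDegree_aeval_X_le (i : Fin 2) (q : Polynomial ℤ) :
    (Polynomial.aeval (X i : MvPolynomial (Fin 2) ℝ) q).totalDegree ≤ q.natDegree := by
  rw [Polynomial.aeval_eq_sum_range]
  refine totalDegree_finsetSum_le fun j hj => ?_
  refine (totalDegree_smul_le _ _).trans ?_
  rw [totalDegree_X_pow]
  exact Nat.lt_succ_iff.1 (Finset.mem_range.1 hj)

/-- The polynomial factor of a linear combination of products of Hermite functions. -/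
noncomputable def hermiteSum (s : Finset (ℕ × ℕ)) (c : ℕ × ℕ → ℝ) : MvPolynomial (Fin 2) ℝ :=
  ∑ ab ∈ s, C (c ab) * Polynomial.aeval (X 0) (Polynomial.hermite ab.1) *
    Polynomial.aeval (X 1) (Polynomial.hermite ab.2)

theorem totalDegree_hermiteSum_le {s : Finset (ℕ × ℕ)} {k : ℕ} (hs : ∀ ab ∈ s, ab.1 + ab.2 ≤ k)
    (c : ℕ × ℕ → ℝ) : (hermiteSum s c).totalDegree ≤ k := by
  refine totalDegree_finsetSum_le fun ab hab => ?_
  have h0 := totalDegree_aeval_X_le 0 (Polynomial.hermite ab.1)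
  have h1 := totalDegree_aeval_X_le 1 (Polynomial.hermite ab.2)
  rw [Polynomial.natDegree_hermite] at h0 h1
  refine (totalDegree_mul _ _).trans ?_
  have h2 := totalDegree_mul (C (c ab)) (Polynomial.aeval (X 0 : MvPolynomial (Fin 2) ℝ)
    (Polynomial.hermite ab.1))
  rw [totalDegree_C] at h2
  have := hs ab hab
  omega

theorem eval_hermiteSum (s : Finset (ℕ × ℕ)) (c : ℕ × ℕ → ℝ) (x y : ℝ) :
    MvPolynomial.eval ![x, y] (hermiteSum s c) =
      ∑ ab ∈ s, c ab * Polynomial.aeval x (Polynomial.hermite ab.1) *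
        Polynomial.aeval y (Polynomial.hermite ab.2) := by
  have h : ∀ (i : Fin 2) (q : Polynomial ℤ), MvPolynomial.eval ![x, y]
      (Polynomial.aeval (X i) q) = Polynomial.aeval (![x, y] i) q := fun i q => by
    simp [Polynomial.aeval_eq_sum_range]
  simp [hermiteSum, h]

end Hermite

end NodalCount

open NodalCount

/-- (Extended Courant property for the isotropic quantum harmonic
oscillator in `ℝ²`.) A nonzero linear combination
`f(x,y) = Σ_{a+b ≤ k} c(a,b) · exp(−(x²+y²)/2) · H_a(x) · H_b(y)`
of eigenfunctions of `−Δ + x² + y²` with eigenvalue at most `2(k+1)` has at most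
`k(k+1)/2 + 1` nodal domains. -/
theorem nodal_domains_of_harmonic_oscillator_combination_le
    (k : ℕ) (c : ℕ × ℕ → ℝ) (hc : ∀ a b : ℕ, k < a + b → c (a, b) = 0)
    (f : ℝ × ℝ → ℝ)
    (hf : ∀ x y : ℝ, f (x, y) =
      ∑ ab ∈ (Finset.range (k + 1) ×ˢ Finset.range (k + 1)).filter
          (fun ab => ab.1 + ab.2 ≤ k),
        c ab * Real.exp (-(x ^ 2 + y ^ 2) / 2) *
          (Polynomial.aeval x (Polynomial.hermite ab.1)) *
          (Polynomial.aeval y (Polynomial.hermite ab.2)))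
    (hne : f ≠ 0) :
    Nat.card (ConnectedComponents {p : ℝ × ℝ // f p ≠ 0}) ≤ k * (k + 1) / 2 + 1 := by
  set s := (Finset.range (k + 1) ×ˢ Finset.range (k + 1)).filter
    (fun ab : ℕ × ℕ => ab.1 + ab.2 ≤ k) with hs
  have hfp : ∀ z : ℝ × ℝ, f z = Real.exp (-(z.1 ^ 2 + z.2 ^ 2) / 2) *
      MvPolynomial.eval ![z.1, z.2] (hermiteSum s c) := by
    intro z
    rw [eval_hermiteSum, Finset.mul_sum, ← Prod.mk.eta (p := z), hf]
    exact Finset.sum_congr rfl fun ab _ => by ring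
  have hp : hermiteSum s c ≠ 0 := fun h => hne (funext fun z => by simp [hfp, h])
  have hreg : {z | f z ≠ 0} = region (slice (hermiteSum s c)) Set.univ := by
    ext z
    simp [region, eval_slice, hfp]
  refine natCard_connectedComponents_le (F := {z | f z ≠ 0}) fun T hT => ?_
  rw [hreg] at hT
  exact card_le_totalDegree hp
    (totalDegree_hermiteSum_le (fun ab hab => (Finset.mem_filter.1 hab).2) c) hT
end

section
/- Let ℓ ≥ 1 and let f be a polynomial in three real variables of total degree at most ℓ whose restriction to the unit sphere S² = {x ∈ ℝ³ | |x| = 1} is not identically zero. Then the number of connected components of the set {x ∈ S² | f(x) ≠ 0} (with the subspace topology) is at most 8ℓ². In particular, a nonzero sum of spherical harmonics of degree at most ℓ on the round sphere S² has at most 8ℓ² nodal domains. -/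
open MvPolynomial

theorem finrank_restrictTotalDegree_fin_two (K : Type*) [Field K] (m : ℕ) :
    2 * Module.finrank K (restrictTotalDegree (Fin 2) K m) = (m + 1) * (m + 2) := by
  have h1 : Module.finrank K (restrictTotalDegree (Fin 2) K m) =
      Nat.card {n : Fin 2 →₀ ℕ | (n.sum fun _ e => e) ≤ m} :=
    Module.finrank_eq_nat_card_basis (basisRestrictSupport K _)
  have e : {n : Fin 2 →₀ ℕ | (n.sum fun _ e => e) ≤ m} ≃
      (Finset.range (m + 1)).sigma fun k => Finset.HasAntidiagonal.antidiagonal k :=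
    { toFun := fun n => ⟨⟨n.1 0 + n.1 1, (n.1 0, n.1 1)⟩, by
        have := n.2
        simp [Finsupp.sum_fintype, Fin.sum_univ_two] at this ⊢
        omega⟩
      invFun := fun x => ⟨Finsupp.equivFunOnFinite.symm ![x.1.2.1, x.1.2.2], by
        have := x.2
        rw [Finset.mem_sigma, Finset.mem_range, Finset.HasAntidiagonal.mem_antidiagonal] at this
        simp [Finsupp.sum_fintype, Fin.sum_univ_two]
        omega⟩
      left_inv := fun n => by
        ext i; fin_cases i <;> simp
      right_inv := fun x => by
        obtain ⟨⟨k, i, j⟩, h⟩ := x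
        simp at h
        obtain ⟨h, rfl⟩ := h
        simp }
  rw [h1, Nat.card_congr e, Nat.card_eq_fintype_card, Fintype.card_coe, Finset.card_sigma]
  simp only [Finset.Nat.card_antidiagonal]
  clear h1 e
  induction m with
  | zero => simp
  | succ m ih => rw [Finset.sum_range_succ, mul_add, ih]; ring

theorem exists_totalDegree_le_eval_eq_indicator {K σ : Type*} [Field K]
    (S : Finset (σ → K)) (s : σ → K) :
    ∃ L : MvPolynomial σ K, L.totalDegree ≤ S.card ∧ eval s L = 1 ∧
      ∀ t ∈ S, t ≠ s → eval t L = 0 := by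
  classical
  induction S using Finset.induction_on with
  | empty => exact ⟨1, by simp⟩
  | insert a S ha ih =>
    obtain ⟨L, h1, h2, h3⟩ := ih
    by_cases has : a = s
    · refine ⟨L, h1.trans (Finset.card_le_card (Finset.subset_insert _ _)), h2, fun t ht hts => ?_⟩
      rcases Finset.mem_insert.1 ht with rfl | ht
      · exact absurd has hts
      · exact h3 t ht hts
    · obtain ⟨i, hi⟩ := Function.ne_iff.1 has
      have hi' : s i - a i ≠ 0 := sub_ne_zero.2 (Ne.symm hi)
      refine ⟨L * (C (s i - a i)⁻¹ * (X i - C (a i))), ?_, ?_, fun t ht hts => ?_⟩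
      · rw [Finset.card_insert_of_notMem ha]
        refine (totalDegree_mul _ _).trans (add_le_add h1 ((totalDegree_mul _ _).trans ?_))
        rw [totalDegree_C, zero_add]
        exact (totalDegree_sub_C_le _ _).trans (totalDegree_X _).le
      · simp [h2, hi']
      · rcases Finset.mem_insert.1 ht with rfl | ht
        · simp
        · simp [h3 t ht hts]

theorem card_common_zeros_le_mul_totalDegree {K : Type*} [Field K]
    {P Q : MvPolynomial (Fin 2) K} (hQ : Q ≠ 0) (hPQ : IsRelPrime P Q)
    (S : Finset (Fin 2 → K)) (hS : ∀ s ∈ S, eval s P = 0 ∧ eval s Q = 0) :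
    S.card ≤ P.totalDegree * Q.totalDegree := by
  classical
  set p := P.totalDegree with hp
  set q := Q.totalDegree with hq
  set k := S.card with hk
  let V := fun m => restrictTotalDegree (Fin 2) K m
  let T : V (k + q) × V (k + p) →ₗ[K] V (k + p + q) :=
    LinearMap.codRestrict _
      (((LinearMap.mulRight K P).comp (V _).subtype).coprod
        ((LinearMap.mulRight K Q).comp (V _).subtype)) (by
      rintro ⟨⟨A, hA⟩, ⟨B, hB⟩⟩
      rw [mem_restrictTotalDegree] at hA hB
      simp only [LinearMap.coprod_apply, LinearMap.comp_apply, Submodule.subtype_apply,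
        LinearMap.mulRight_apply]
      rw [mem_restrictTotalDegree]
      refine (totalDegree_add _ _).trans (max_le ?_ ?_)
      · exact (totalDegree_mul _ _).trans (by omega)
      · exact (totalDegree_mul _ _).trans (by omega))
  have hT : ∀ A B, (T (A, B) : MvPolynomial (Fin 2) K) = A * P + B * Q := fun A B => rfl
  let ev : V (k + p + q) →ₗ[K] (S → K) :=
    LinearMap.pi fun s => (aeval (R := K) s.1).toLinearMap.comp (V _).subtype
  have hev : ∀ A s, ev A s = eval s.1 (A : MvPolynomial (Fin 2) K) := fun A s => by
    simp [ev, aeval_eq_eval]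
  have hsurj : Function.Surjective ev := by
    choose L h1 h2 h3 using exists_totalDegree_le_eval_eq_indicator S
    intro c
    refine ⟨∑ s : S, c s • ⟨L s, (mem_restrictTotalDegree _ _ _).2
      ((h1 s).trans (by omega))⟩, ?_⟩
    ext t
    rw [map_sum, Finset.sum_apply, Finset.sum_eq_single t]
    · rw [map_smul, Pi.smul_apply, hev]; simp [h2]
    · intro s _ hst
      rw [map_smul, Pi.smul_apply, hev]
      simp [h3 s t t.2 (fun h => hst (Subtype.ext h.symm))]
    · simp
  have hrange : LinearMap.range T ≤ LinearMap.ker ev := by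
    rintro _ ⟨⟨A, B⟩, rfl⟩
    ext s
    rw [hev, hT]
    simp [hS s s.2]
  let W : V k →ₗ[K] V (k + q) × V (k + p) :=
    LinearMap.prod
      (LinearMap.codRestrict _ ((LinearMap.mulRight K Q).comp (V k).subtype) (by
        rintro ⟨A, hA⟩
        rw [mem_restrictTotalDegree] at hA ⊢
        exact (totalDegree_mul _ _).trans (by simpa [← hp, ← hq] using hA)))
      (LinearMap.codRestrict _ ((LinearMap.mulRight K (-P)).comp (V k).subtype) (by
        rintro ⟨A, hA⟩
        rw [mem_restrictTotalDegree] at hA ⊢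
        exact (totalDegree_mul _ _).trans (by simpa [← hp, ← hq] using hA)))
  have hker : LinearMap.ker T ≤ LinearMap.range W := by
    rintro ⟨⟨A, hA⟩, ⟨B, hB⟩⟩ h
    have h : A * P + B * Q = 0 := congrArg Subtype.val (LinearMap.mem_ker.1 h)
    have hd : Q ∣ A := by
      refine IsRelPrime.dvd_of_dvd_mul_right hPQ.symm ⟨-B, ?_⟩
      linear_combination h
    obtain ⟨D, rfl⟩ := hd
    have hB' : B = D * -P := by
      apply mul_left_cancel₀ hQ
      linear_combination h
    have hD : D.totalDegree ≤ k := by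
      by_cases hD : D = 0
      · simp [hD]
      · rw [mem_restrictTotalDegree, totalDegree_mul_of_isDomain hQ hD] at hA
        omega
    refine ⟨⟨D, (mem_restrictTotalDegree _ _ _).2 hD⟩, ?_⟩
    refine Prod.ext (Subtype.ext ?_) (Subtype.ext ?_)
    · exact mul_comm D Q
    · exact hB'.symm
  have e1 := LinearMap.finrank_range_add_finrank_ker ev
  have e2 := LinearMap.finrank_range_add_finrank_ker T
  have e3 := Submodule.finrank_mono hrange
  have e4 := (Submodule.finrank_mono hker).trans (LinearMap.finrank_range_le W)
  rw [LinearMap.range_eq_top.2 hsurj, finrank_top, Module.finrank_fintype_fun_eq_card,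
    Fintype.card_coe] at e1
  rw [Module.finrank_prod] at e2
  have f1 := finrank_restrictTotalDegree_fin_two K (k + p + q)
  have f2 := finrank_restrictTotalDegree_fin_two K (k + p)
  have f3 := finrank_restrictTotalDegree_fin_two K (k + q)
  have f4 := finrank_restrictTotalDegree_fin_two K k
  simp only [V] at e1 e2 e3 e4
  nlinarith

theorem finite_not_isRelPrime_add_C {K σ : Type*} [Field K] {P : MvPolynomial σ K} (hP : P ≠ 0)
    (Q : MvPolynomial σ K) : {b : K | ¬ IsRelPrime P (Q + C b)}.Finite := by
  classical
  have key : ∀ b ∈ {b : K | ¬ IsRelPrime P (Q + C b)},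
      ∃ r ∈ UniqueFactorizationMonoid.factors P, r ∣ Q + C b := by
    intro b hb
    by_contra! h
    refine hb (WfDvdMonoid.isRelPrime_of_no_irreducible_factors (fun h => hP h.1) ?_)
    intro z hz hzP hzQ
    obtain ⟨r, hr, hzr⟩ := UniqueFactorizationMonoid.exists_mem_factors_of_dvd hP hz hzP
    exact h r hr (hzr.symm.dvd.trans hzQ)
  choose! r hr hd using key
  refine Set.Finite.of_finite_image (f := r)
    ((Multiset.toFinset (UniqueFactorizationMonoid.factors P)).finite_toSet.subset ?_) ?_
  · rintro _ ⟨b, hb, rfl⟩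
    simpa using hr b hb
  · intro b hb b' hb' hbb
    by_contra hne
    have h1 : r b ∣ C (b - b') := by
      have := dvd_sub (hd b hb) (hbb ▸ hd b' hb')
      simpa using this
    have h2 : IsUnit (r b) := isUnit_of_dvd_unit h1 ((isUnit_iff_ne_zero.2 (sub_ne_zero.2 hne)).map C)
    exact (UniqueFactorizationMonoid.irreducible_of_factor _ (hr b hb)).not_isUnit h2

theorem totalDegree_pderiv_le {R σ : Type*} [CommSemiring R] (i : σ) (f : MvPolynomial σ R) :
    (pderiv i f).totalDegree ≤ f.totalDegree := by
  classical
  conv_lhs => rw [f.as_sum, map_sum]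
  refine totalDegree_finsetSum_le fun m hm => ?_
  rw [pderiv_monomial]
  refine (totalDegree_monomial_le _ _).trans (le_trans ?_ (le_totalDegree hm))
  exact Finsupp.degree_mono tsub_le_self

theorem hasDerivAt_eval_update {σ : Type*} [DecidableEq σ] (f : MvPolynomial σ ℝ) (z : σ → ℝ)
    (i : σ) (t : ℝ) : HasDerivAt (fun t => eval (Function.update z i t) f)
      (eval (Function.update z i t) (pderiv i f)) t := by
  induction f using MvPolynomial.induction_on with
  | C a => simpa using hasDerivAt_const t a
  | add p q hp hq => simpa using! hp.add hq
  | mul_X p j hp =>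
    have hX : HasDerivAt (fun t => eval (Function.update z i t) (X j))
        (eval (Function.update z i t) (pderiv i (X j))) t := by
      by_cases hij : j = i
      · subst hij; simpa using! hasDerivAt_id t
      · simpa [pderiv_X_of_ne (Ne.symm hij), hij] using hasDerivAt_const t (z j)
    have := hp.mul hX
    simp only [map_mul, Derivation.leibniz, map_add, smul_eq_mul]
    rw [add_comm, mul_comm (eval _ (X j))]
    exact this

theorem eval_pderiv_eq_zero_of_isLocalExtr {σ : Type*} {f : MvPolynomial σ ℝ}
    {z : σ → ℝ} (h : IsLocalExtr (fun x => eval x f) z) (i : σ) : eval z (pderiv i f) = 0 := by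
  classical
  have hd := hasDerivAt_eval_update f z i (z i)
  rw [Function.update_eq_self] at hd
  refine IsLocalExtr.hasDerivAt_eq_zero (a := z i) ?_ hd
  have hc : Continuous fun t => Function.update z i t := by fun_prop
  have hz : Function.update z i (z i) = z := Function.update_eq_self _ _
  have := hc.tendsto (z i)
  rw [hz] at this
  rcases h with h | h
  · left
    filter_upwards [this.eventually h] with t ht
    simpa [hz] using ht
  · right
    filter_upwards [this.eventually h] with t ht
    simpa [hz] using ht

theorem finite_add_C_eq_zero {R σ : Type*} [CommRing R] (Q : MvPolynomial σ R) :
    {a : R | Q + C a = 0}.Finite := by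
  refine Set.Subsingleton.finite fun a ha b hb => C_injective σ R ?_
  exact add_left_cancel (Eq.trans ha (Eq.symm hb))

theorem exists_isLocalExtr_of_abs_lt_on_frontier {X : Type*} [TopologicalSpace X] {U : Set X}
    (hU : IsOpen U) (hc : IsCompact (closure U)) {f : X → ℝ} (hf : Continuous f) {x : X}
    (hx : x ∈ U) (hfr : ∀ y ∈ frontier U, |f y| < |f x|) : ∃ z ∈ U, IsLocalExtr f z := by
  obtain ⟨z, hz, hmax⟩ :=
    hc.exists_isMaxOn ⟨x, subset_closure hx⟩ hf.abs.continuousOn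
  have hzU : z ∈ U := by
    by_contra h
    exact absurd (hmax (subset_closure hx)) (hfr z ⟨hz, by rwa [hU.interior_eq]⟩).not_ge
  refine ⟨z, hzU, ?_⟩
  have hev : ∀ᶠ y in nhds z, |f y| ≤ |f z| := by
    filter_upwards [hU.mem_nhds hzU] with y hy using hmax (subset_closure hy)
  rcases le_total 0 (f z) with h | h
  · right
    filter_upwards [hev] with y hy
    rw [abs_of_nonneg h] at hy
    exact (le_abs_self _).trans hy
  · left
    filter_upwards [hev] with y hy
    rw [abs_of_nonpos h] at hy
    linarith [neg_abs_le (f y)]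

theorem card_bounded_domains_le_totalDegree_sq {ι : Type*} [Fintype ι]
    (g : MvPolynomial (Fin 2) ℝ) (U : ι → Set (Fin 2 → ℝ)) (hU : ∀ i, IsOpen (U i))
    (hb : ∀ i, Bornology.IsBounded (U i)) (hdisj : Pairwise (Function.onFun Disjoint U))
    (hne : ∀ i, ∃ x ∈ U i, eval x g ≠ 0) (hfr : ∀ i, ∀ x ∈ frontier (U i), eval x g = 0) :
    Fintype.card ι ≤ g.totalDegree ^ 2 := by
  classical
  choose x hxU hx using hne
  obtain ⟨δ, hδx, hδ⟩ : ∃ δ : ℝ, (∀ i, δ < |eval (x i) g|) ∧ 0 < δ := by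
    have h1 : ∀ᶠ δ in nhdsWithin (0 : ℝ) (Set.Ioi 0), ∀ i, δ < |eval (x i) g| :=
      Filter.eventually_all.2 fun i =>
        (eventually_lt_nhds (abs_pos.2 (hx i))).filter_mono nhdsWithin_le_nhds
    exact (h1.and self_mem_nhdsWithin).exists
  obtain ⟨R, hR, hUR⟩ :=
    ((Bornology.isBounded_iUnion.2 hb).closure).exists_pos_norm_le
  have hclU : ∀ i, ∀ y ∈ closure (U i), ∀ j, |y j| ≤ R := fun i y hy j =>
    (norm_le_pi_norm y j).trans (hUR y (closure_mono (Set.subset_iUnion U i) hy))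
  obtain ⟨η, hη, hηR⟩ : ∃ η : ℝ, 0 < η ∧ 4 * (η * R) = δ :=
    ⟨δ / (4 * R), by positivity, by field_simp⟩
  obtain ⟨a, ⟨ha0, haη⟩, ha⟩ :=
    (Set.Ioo_infinite hη).exists_notMem_finite (finite_add_C_eq_zero (pderiv 0 g))
  obtain ⟨b, ⟨hb0, hbη⟩, hb'⟩ :=
    (Set.Ioo_infinite hη).exists_notMem_finite
      ((finite_add_C_eq_zero (pderiv 1 g)).union (finite_not_isRelPrime_add_C ha (pderiv 1 g)))
  rw [Set.mem_union, not_or] at hb'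
  obtain ⟨hbQ, hrel⟩ := hb'
  replace hrel := not_not.1 hrel
  let h := g + C a * X 0 + C b * X 1
  have hh : ∀ y, eval y h = eval y g + (a * y 0 + b * y 1) := fun y => by
    simp [h, add_assoc]
  have h0 : pderiv 0 h = pderiv 0 g + C a := by
    simp [h, Derivation.leibniz]
  have h1 : pderiv 1 h = pderiv 1 g + C b := by
    simp [h, Derivation.leibniz]
  have hsmall : ∀ i, ∀ y ∈ closure (U i), |a * y 0 + b * y 1| ≤ δ / 2 := by
    intro i y hy
    calc |a * y 0 + b * y 1| ≤ |a * y 0| + |b * y 1| := abs_add_le _ _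
      _ = a * |y 0| + b * |y 1| := by rw [abs_mul, abs_mul, abs_of_pos ha0, abs_of_pos hb0]
      _ ≤ η * R + η * R := by
        gcongr
        · exact hclU i y hy 0
        · exact hclU i y hy 1
      _ = δ / 2 := by linarith
  have hcrit : ∀ i, ∃ z ∈ U i, IsLocalExtr (fun y => eval y h) z := fun i => by
    refine exists_isLocalExtr_of_abs_lt_on_frontier (hU i) (hb i).isCompact_closure
      (continuous_eval h) (hxU i) fun y hy => ?_
    have e1 := hsmall i y (frontier_subset_closure hy)
    have e2 := hsmall i (x i) (subset_closure (hxU i))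
    have e3 := hδx i
    have e4 := abs_sub_abs_le_abs_add (eval (x i) g) (a * x i 0 + b * x i 1)
    rw [hh, hh, hfr i y hy, zero_add]
    linarith
  choose z hzU hz using hcrit
  have hinj : Function.Injective z := fun i j hij => by
    by_contra hne
    exact Set.disjoint_left.1 (hdisj hne) (hzU i) (hij ▸ hzU j)
  have hcard := card_common_zeros_le_mul_totalDegree (P := pderiv 0 g + C a)
    (Q := pderiv 1 g + C b) hbQ hrel (Finset.univ.image z) (by
      intro s hs
      obtain ⟨i, -, rfl⟩ := Finset.mem_image.1 hs
      rw [← h0, ← h1]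
      exact ⟨eval_pderiv_eq_zero_of_isLocalExtr (hz i) 0,
        eval_pderiv_eq_zero_of_isLocalExtr (hz i) 1⟩)
  have hdeg : ∀ (i : Fin 2) (c : ℝ), (pderiv i g + C c).totalDegree ≤ g.totalDegree :=
    fun i c => (totalDegree_add _ _).trans (max_le (totalDegree_pderiv_le i g) (by simp))
  rw [Finset.card_image_of_injective _ hinj, Finset.card_univ] at hcard
  rw [sq]
  exact hcard.trans (Nat.mul_le_mul (hdeg 0 a) (hdeg 1 b))

theorem exists_homogenized_comp {K σ τ : Type*} [Field K] (f : MvPolynomial σ K) {l d : ℕ}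
    (hf : f.totalDegree ≤ l) (N : σ → MvPolynomial τ K) (W : MvPolynomial τ K)
    (hN : ∀ i, (N i).totalDegree ≤ d) (hW : W.totalDegree ≤ d) :
    ∃ g : MvPolynomial τ K, g.totalDegree ≤ l * d ∧ ∀ (u : τ → K) (x : σ → K),
      (∀ i, eval u (N i) = eval u W * x i) → eval u g = eval u W ^ l * eval x f := by
  refine ⟨∑ m ∈ f.support, C (coeff m f) * W ^ (l - m.degree) * ∏ i ∈ m.support, N i ^ m i,
    totalDegree_finsetSum_le fun m hm => ?_, fun u x hux => ?_⟩
  · have hm : m.degree ≤ l := (le_totalDegree hm).trans hf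
    refine (totalDegree_mul _ _).trans ?_
    have e1 : (C (coeff m f) * W ^ (l - m.degree)).totalDegree ≤ (l - m.degree) * d := by
      refine (totalDegree_mul _ _).trans ?_
      rw [totalDegree_C, zero_add]
      exact (totalDegree_pow _ _).trans (Nat.mul_le_mul_left _ hW)
    have e2 : (∏ i ∈ m.support, N i ^ m i).totalDegree ≤ m.degree * d := by
      refine (totalDegree_finsetProd _ _).trans ?_
      rw [Finsupp.degree_apply, Finset.sum_mul]
      exact Finset.sum_le_sum fun i _ =>
        (totalDegree_pow _ _).trans (Nat.mul_le_mul_left _ (hN i))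
    calc _ ≤ (l - m.degree) * d + m.degree * d := add_le_add e1 e2
      _ = l * d := by rw [← add_mul, Nat.sub_add_cancel hm]
  · rw [map_sum, eval_eq x f, Finset.mul_sum]
    refine Finset.sum_congr rfl fun m hm => ?_
    have hm : m.degree ≤ l := (le_totalDegree hm).trans hf
    simp only [map_mul, map_pow, map_prod, eval_C, hux, mul_pow, Finset.prod_mul_distrib]
    rw [Finset.prod_pow_eq_pow_sum, ← Finsupp.degree_apply]
    conv_rhs => rw [← Nat.sub_add_cancel hm, pow_add]
    ring

theorem exists_orthogonal_matrix_row {p : Fin 3 → ℝ} (hp : ∑ i, p i ^ 2 = 1) :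
    ∃ M : Matrix (Fin 3) (Fin 3) ℝ, M * M.transpose = 1 ∧ M 2 = p := by
  have hv : Orthonormal ℝ (({2} : Set (Fin 3)).domRestrict
      fun _ : Fin 3 => (WithLp.toLp 2 p : EuclideanSpace ℝ (Fin 3))) := by
    refine ⟨fun i => ?_, fun i j hij => absurd (Subsingleton.elim i j) hij⟩
    simp [Set.domRestrict_apply, EuclideanSpace.norm_eq, hp]
  obtain ⟨b, hb⟩ := hv.exists_orthonormalBasis_extension_of_card_eq (by simp)
  refine ⟨Matrix.of fun k i => b k i, ?_, ?_⟩
  · ext k l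
    have := orthonormal_iff_ite.1 b.orthonormal k l
    rw [PiLp.inner_apply] at this
    simpa [Matrix.mul_apply, Matrix.one_apply, mul_comm] using this
  · ext i
    simp [hb 2 rfl]

/-- Inverse stereographic projection from `p`, as a quotient of polynomials of degree two. -/
theorem exists_inverse_stereographic {p : Fin 3 → ℝ} (hp : ∑ i, p i ^ 2 = 1) :
    ∃ (s : (Fin 2 → ℝ) → Fin 3 → ℝ) (N : Fin 3 → MvPolynomial (Fin 2) ℝ),
      Continuous s ∧ (∀ u, ∑ i, s u i ^ 2 = 1) ∧
      (∀ x : Fin 3 → ℝ, ∑ i, x i ^ 2 = 1 → x ≠ p → ∃ u, s u = x) ∧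
      (∀ u i, (s u i - p i) ^ 2 * (1 + u 0 ^ 2 + u 1 ^ 2) ≤ 4) ∧
      (∀ i, (N i).totalDegree ≤ 2) ∧
      ∀ u i, eval u (N i) = (1 + u 0 ^ 2 + u 1 ^ 2) * s u i := by
  obtain ⟨M, hM, rfl⟩ := exists_orthogonal_matrix_row hp
  have hM' := mul_eq_one_comm.1 hM
  have row : ∀ k l, M k 0 * M l 0 + M k 1 * M l 1 + M k 2 * M l 2 = if k = l then 1 else 0 :=
    fun k l => by
      simpa [Matrix.mul_apply, Matrix.one_apply, Fin.sum_univ_three] using congrFun₂ hM k l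
  have col : ∀ i j, M 0 i * M 0 j + M 1 i * M 1 j + M 2 i * M 2 j = if i = j then 1 else 0 :=
    fun i j => by
      simpa [Matrix.mul_apply, Matrix.one_apply, Fin.sum_univ_three] using congrFun₂ hM' i j
  have r00 := row 0 0
  have r11 := row 1 1
  have r22 := row 2 2
  have r01 := row 0 1
  have r02 := row 0 2
  have r12 := row 1 2
  simp at r00 r11 r22 r01 r02 r12
  have hpos : ∀ u : Fin 2 → ℝ, 0 < 1 + u 0 ^ 2 + u 1 ^ 2 := fun u => by positivity
  let n : (Fin 2 → ℝ) → Fin 3 → ℝ := fun u i =>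
    2 * u 0 * M 0 i + 2 * u 1 * M 1 i + (u 0 ^ 2 + u 1 ^ 2 - 1) * M 2 i
  have hsq : ∀ u, ∑ i, (n u i / (1 + u 0 ^ 2 + u 1 ^ 2)) ^ 2 = 1 := fun u => by
    have := (hpos u).ne'
    simp only [div_pow, Fin.sum_univ_three, n]
    field_simp
    linear_combination 4 * u 0 ^ 2 * r00 + 4 * u 1 ^ 2 * r11 +
      (u 0 ^ 2 + u 1 ^ 2 - 1) ^ 2 * r22 + 8 * u 0 * u 1 * r01 +
      4 * u 0 * (u 0 ^ 2 + u 1 ^ 2 - 1) * r02 + 4 * u 1 * (u 0 ^ 2 + u 1 ^ 2 - 1) * r12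
  have hdist : ∀ u, ∑ i, (n u i / (1 + u 0 ^ 2 + u 1 ^ 2) - M 2 i) ^ 2 *
      (1 + u 0 ^ 2 + u 1 ^ 2) = 4 := fun u => by
    have := (hpos u).ne'
    simp only [Fin.sum_univ_three, n]
    field_simp
    linear_combination 4 * u 0 ^ 2 * r00 + 4 * u 1 ^ 2 * r11 +
      4 * r22 + 8 * u 0 * u 1 * r01 - 8 * u 0 * r02 - 8 * u 1 * r12
  refine ⟨fun u i => n u i / (1 + u 0 ^ 2 + u 1 ^ 2),
    fun i => C (2 * M 0 i) * X 0 + C (2 * M 1 i) * X 1 + C (M 2 i) * (X 0 ^ 2 + X 1 ^ 2 - 1),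
    ?_, hsq, ?_, fun u i => ?_, fun i => ?_, fun u i => ?_⟩
  · refine continuous_pi fun i => Continuous.div (by fun_prop) (by fun_prop) fun u => (hpos u).ne'
  · intro x hx hxp
    let y : Fin 3 → ℝ := fun k => M k 0 * x 0 + M k 1 * x 1 + M k 2 * x 2
    have hxy : ∀ i, x i = y 0 * M 0 i + y 1 * M 1 i + y 2 * M 2 i := fun i => by
      have c0 := col 0 i
      have c1 := col 1 i
      have c2 := col 2 i
      simp only [y]
      fin_cases i <;> simp at c0 c1 c2 ⊢ <;>
        linear_combination -(x 0 * c0) - x 1 * c1 - x 2 * c2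
    have hy : y 0 ^ 2 + y 1 ^ 2 + y 2 ^ 2 = 1 := by
      rw [← hx, Fin.sum_univ_three, hxy 0, hxy 1, hxy 2]
      linear_combination -(y 0 ^ 2 * r00) - y 1 ^ 2 * r11 - y 2 ^ 2 * r22 -
        2 * y 0 * y 1 * r01 - 2 * y 0 * y 2 * r02 - 2 * y 1 * y 2 * r12
    have hy2 : 1 - y 2 ≠ 0 := fun h => by
      apply hxp
      have e2 : y 2 = 1 := by linarith
      have e0 : y 0 = 0 := by nlinarith [sq_nonneg (y 0), sq_nonneg (y 1)]
      have e1 : y 1 = 0 := by nlinarith [sq_nonneg (y 0), sq_nonneg (y 1)]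
      ext i
      rw [hxy i, e0, e1, e2]
      ring
    refine ⟨![y 0 / (1 - y 2), y 1 / (1 - y 2)], ?_⟩
    have hs : (y 0 / (1 - y 2)) ^ 2 + (y 1 / (1 - y 2)) ^ 2 = (1 + y 2) / (1 - y 2) := by
      field_simp
      linear_combination hy
    have hs1 : 1 + (y 0 / (1 - y 2)) ^ 2 + (y 1 / (1 - y 2)) ^ 2 = 2 / (1 - y 2) := by
      rw [add_assoc, hs]
      field_simp
      ring
    ext i
    simp only [n, Matrix.cons_val_zero, Matrix.cons_val_one]
    rw [hs1, hs, hxy i]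
    field_simp
    ring
  · rw [← hdist u]
    exact Finset.single_le_sum (f := fun i => (n u i / (1 + u 0 ^ 2 + u 1 ^ 2) - M 2 i) ^ 2 *
      (1 + u 0 ^ 2 + u 1 ^ 2)) (fun j _ => mul_nonneg (sq_nonneg _) (hpos u).le)
      (Finset.mem_univ i)
  · have hX : ∀ (c : ℝ) (j : Fin 2), (C c * X j : MvPolynomial (Fin 2) ℝ).totalDegree ≤ 2 :=
      fun c j => (totalDegree_mul _ _).trans (by simp)
    refine (totalDegree_add _ _).trans (max_le ((totalDegree_add _ _).trans
      (max_le (hX _ _) (hX _ _))) ((totalDegree_mul _ _).trans ?_))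
    rw [totalDegree_C, zero_add]
    refine (totalDegree_sub _ _).trans (max_le ((totalDegree_add _ _).trans (max_le ?_ ?_)) ?_)
      <;> simp [totalDegree_X_pow]
  · simp only [map_add, map_sub, map_mul, map_pow, map_one, eval_C, eval_X, n]
    rw [mul_div_cancel₀ _ (hpos u).ne']
    ring

/-- A polynomial of degree at most `ℓ ≥ 1` in three real variables whose
restriction to the unit sphere `S²` is not identically zero has at most `8ℓ²` nodal domains
on `S²`. In particular, a nonzero sum of spherical harmonics of degree at most `ℓ` has at
most `8ℓ²` nodal domains. -/
theorem nodal_domains_on_sphere_le_of_degree_le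
    (ℓ : ℕ) (hℓ : 1 ≤ ℓ) (f : MvPolynomial (Fin 3) ℝ) (hdeg : f.totalDegree ≤ ℓ)
    (hne : ∃ x : Fin 3 → ℝ, (∑ i, x i ^ 2 = 1) ∧ MvPolynomial.eval x f ≠ 0) :
    Nat.card (ConnectedComponents
      {x : Fin 3 → ℝ // (∑ i, x i ^ 2 = 1) ∧ MvPolynomial.eval x f ≠ 0}) ≤ 8 * ℓ ^ 2 := by
  classical
  obtain ⟨p, hp1, hpf⟩ := hne
  let Y := {x : Fin 3 → ℝ // (∑ i, x i ^ 2 = 1) ∧ MvPolynomial.eval x f ≠ 0}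
  change Nat.card (ConnectedComponents Y) ≤ 8 * ℓ ^ 2
  rcases finite_or_infinite (ConnectedComponents Y) with hfin | hinf
  swap
  · simp
  have := Fintype.ofFinite (ConnectedComponents Y)
  obtain ⟨s, N, hs, hs1, hsurj, hsp, hN, hNs⟩ := exists_inverse_stereographic hp1
  have hW : (1 + X 0 ^ 2 + X 1 ^ 2 : MvPolynomial (Fin 2) ℝ).totalDegree ≤ 2 := by
    refine (totalDegree_add _ _).trans (max_le ((totalDegree_add _ _).trans (max_le ?_ ?_)) ?_)
      <;> simp [totalDegree_X_pow]
  obtain ⟨g, hg, hgf⟩ := exists_homogenized_comp f hdeg N _ hN hW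
  have hpos : ∀ u : Fin 2 → ℝ, 0 < 1 + u 0 ^ 2 + u 1 ^ 2 := fun u => by positivity
  have hgs : ∀ u, eval u g ≠ 0 ↔ eval (s u) f ≠ 0 := fun u => by
    rw [hgf u (s u) fun i => by simp [hNs]]
    have : (1 + u 0 ^ 2 + u 1 ^ 2) ^ ℓ ≠ 0 := pow_ne_zero _ (hpos u).ne'
    simp [this]
  let φ : {u | eval u g ≠ 0} → Y := fun u => ⟨s u, hs1 u, (hgs u).1 u.2⟩
  have hφ : Continuous φ := (hs.comp continuous_subtype_val).subtype_mk _
  have hO : IsOpen {u | eval u g ≠ 0} := isOpen_ne_fun (continuous_eval g) continuous_const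
  let U : ConnectedComponents Y → Set (Fin 2 → ℝ) := fun c =>
    Subtype.val '' ((fun u => ConnectedComponents.mk (φ u)) ⁻¹' {c})
  have hU : ∀ c, IsOpen (U c) := fun c =>
    hO.isOpenMap_subtype_val _
      ((isOpen_discrete {c}).preimage (ConnectedComponents.continuous_coe.comp hφ))
  have hdisj : Pairwise (Function.onFun Disjoint U) := fun c c' hcc => by
    refine Set.disjoint_left.2 ?_
    rintro _ ⟨u, rfl, rfl⟩ ⟨v, rfl, hv⟩
    exact hcc (by rw [Subtype.ext hv])
  have hfr : ∀ c, ∀ u ∈ frontier (U c), eval u g = 0 := fun c u hu => by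
    by_contra hug
    have hmem : u ∈ U (ConnectedComponents.mk (φ ⟨u, hug⟩)) := ⟨⟨u, hug⟩, rfl, rfl⟩
    rw [(hU c).frontier_eq] at hu
    by_cases hc : ConnectedComponents.mk (φ ⟨u, hug⟩) = c
    · exact hu.2 (hc ▸ hmem)
    · exact Set.disjoint_left.1 ((hdisj hc).closure_right (hU _)) hmem hu.1
  let c₀ : ConnectedComponents Y := ConnectedComponents.mk ⟨p, hp1, hpf⟩
  have hnonempty : ∀ c, c ≠ c₀ → ∃ u ∈ U c, eval u g ≠ 0 := fun c hc => by
    obtain ⟨⟨x, hx1, hxf⟩, rfl⟩ := ConnectedComponents.surjective_coe c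
    have hxp : x ≠ p := by
      rintro rfl
      exact hc rfl
    obtain ⟨u, rfl⟩ := hsurj x hx1 hxp
    exact ⟨u, ⟨⟨u, (hgs u).2 hxf⟩, rfl, rfl⟩, (hgs u).2 hxf⟩
  have hbdd : ∀ c, c ≠ c₀ → Bornology.IsBounded (U c) := fun c hc => by
    have hopen : IsOpen (ConnectedComponents.mk ⁻¹' {c₀} : Set Y) :=
      (isOpen_discrete {c₀}).preimage ConnectedComponents.continuous_coe
    obtain ⟨ε, hε, hball⟩ := Metric.isOpen_iff.1 hopen ⟨p, hp1, hpf⟩ rfl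
    refine (Metric.isBounded_closedBall (x := (0 : Fin 2 → ℝ)) (r := 1 + 4 / ε ^ 2)).subset ?_
    rintro _ ⟨u, rfl, rfl⟩
    have hfar : ¬ dist (s u) p < ε := fun h => hc (hball (a := φ u) h)
    rw [dist_pi_lt_iff hε] at hfar
    push Not at hfar
    obtain ⟨i, hi⟩ := hfar
    rw [Real.dist_eq] at hi
    have h1 : ε ^ 2 ≤ (s u i - p i) ^ 2 := by
      rw [← sq_abs (s u i - p i)]
      gcongr
    have h2 : 1 + u.1 0 ^ 2 + u.1 1 ^ 2 ≤ 4 / ε ^ 2 := by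
      rw [le_div_iff₀' (by positivity)]
      exact (mul_le_mul_of_nonneg_right h1 (hpos u).le).trans (hsp u i)
    rw [mem_closedBall_zero_iff, pi_norm_le_iff_of_nonneg (by positivity), Fin.forall_fin_two]
    simp only [Real.norm_eq_abs, abs_le]
    refine ⟨⟨?_, ?_⟩, ?_, ?_⟩ <;> nlinarith [sq_nonneg (u.1 0 - 1), sq_nonneg (u.1 0 + 1),
      sq_nonneg (u.1 1 - 1), sq_nonneg (u.1 1 + 1)]
  have hcard := card_bounded_domains_le_totalDegree_sq g
    (fun c : {c : ConnectedComponents Y // c ≠ c₀} => U c) (fun c => hU c)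
    (fun c => hbdd c c.2) (fun c c' h => hdisj (Subtype.coe_injective.ne h))
    (fun c => hnonempty c c.2) (fun c => hfr c)
  rw [Fintype.card_subtype_compl, Fintype.card_subtype_eq] at hcard
  rw [Nat.card_eq_fintype_card]
  have hg2 := Nat.pow_le_pow_left hg 2
  have hl2 := Nat.one_le_pow 2 ℓ hℓ
  rw [mul_pow] at hg2
  omega
end

section
/- Define f : ℝ → ℝ by f(x) = exp(−1/x²)·cos(1/x²) for x ≠ 0 and f(0) = 0. Then f is infinitely differentiable on ℝ, and for every x ≠ 0 one has f(x) = 0 if and only if there exists k ∈ ℕ with x²·(π/2 + kπ) = 1. Consequently the zero set of f is {0} ∪ {±(π/2 + kπ)^{−1/2} : k ∈ ℕ}, an infinite set whose only accumulation point is 0. -/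
open Real

section Smoothness

open Polynomial Filter Topology

theorem tendsto_polynomial_inv_mul_expNegInvGlue_sq (p : ℝ[X]) :
    Tendsto (fun x ↦ p.eval x⁻¹ * expNegInvGlue (x ^ 2)) (𝓝 0) (𝓝 0) := by
  induction p using Polynomial.induction_on' with
  | add p q hp hq => simpa [add_mul] using hp.add hq
  | monomial n a =>
    have hsq : Tendsto (fun x : ℝ ↦ x ^ 2) (𝓝 0) (𝓝 0) :=
      (continuous_pow 2).tendsto' 0 0 (by simp)
    have hglue :=
      (expNegInvGlue.tendsto_polynomial_inv_mul_zero (monomial n a)).comp hsq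
    have hpow : Tendsto (fun x : ℝ ↦ x ^ n) (𝓝 0) (𝓝 (0 ^ n)) :=
      (continuous_pow n).tendsto 0
    have hmul := hpow.mul hglue
    rw [mul_zero] at hmul
    refine hmul.congr fun x ↦ ?_
    rcases eq_or_ne x 0 with rfl | hx
    · simp
    · have hxn : x ^ n * ((x ^ 2)⁻¹) ^ n = x⁻¹ ^ n := by
        rw [← mul_pow]
        congr 1
        field_simp
      simp only [Function.comp_apply, eval_monomial, ← hxn]
      ring

/-- The functions obtained from `x ↦ exp (-1/x²) cos (1/x²)` by repeated differentiation. -/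
noncomputable def oscillatingGlue (p q : ℝ[X]) (x : ℝ) : ℝ :=
  expNegInvGlue (x ^ 2) *
    (p.eval x⁻¹ * Real.cos (x⁻¹ ^ 2) + q.eval x⁻¹ * Real.sin (x⁻¹ ^ 2))

theorem tendsto_oscillatingGlue_zero (p q : ℝ[X]) :
    Tendsto (oscillatingGlue p q) (𝓝 0) (𝓝 0) := by
  have hp := (tendsto_polynomial_inv_mul_expNegInvGlue_sq p).abs
  have hq := (tendsto_polynomial_inv_mul_expNegInvGlue_sq q).abs
  have hpq := hp.add hq
  rw [abs_zero, add_zero] at hpq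
  refine squeeze_zero_norm (fun x ↦ ?_) hpq
  calc ‖oscillatingGlue p q x‖
      = |p.eval x⁻¹ * expNegInvGlue (x ^ 2) * Real.cos (x⁻¹ ^ 2) +
          q.eval x⁻¹ * expNegInvGlue (x ^ 2) * Real.sin (x⁻¹ ^ 2)| := by
        rw [Real.norm_eq_abs, oscillatingGlue]
        ring_nf
    _ ≤ |p.eval x⁻¹ * expNegInvGlue (x ^ 2)| * |Real.cos (x⁻¹ ^ 2)| +
          |q.eval x⁻¹ * expNegInvGlue (x ^ 2)| * |Real.sin (x⁻¹ ^ 2)| := by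
        rw [← abs_mul, ← abs_mul]
        exact abs_add_le _ _
    _ ≤ _ := add_le_add
        (mul_le_of_le_one_right (abs_nonneg _) (Real.abs_cos_le_one _))
        (mul_le_of_le_one_right (abs_nonneg _) (Real.abs_sin_le_one _))

theorem hasDerivAt_oscillatingGlue (p q : ℝ[X]) (x : ℝ) :
    HasDerivAt (oscillatingGlue p q)
      (oscillatingGlue (X ^ 2 * (2 * X * p - derivative p - 2 * X * q))
        (X ^ 2 * (2 * X * q - derivative q + 2 * X * p)) x) x := by
  rcases eq_or_ne x 0 with rfl | hx
  · rw [hasDerivAt_iff_tendsto_slope]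
    have h := (tendsto_oscillatingGlue_zero (X * p) (X * q)).mono_left
      (nhdsWithin_le_nhds (s := {0}ᶜ))
    have h0 : oscillatingGlue (X ^ 2 * (2 * X * p - derivative p - 2 * X * q))
        (X ^ 2 * (2 * X * q - derivative q + 2 * X * p)) 0 = 0 := by
      simp [oscillatingGlue]
    rw [h0]
    refine h.congr fun x ↦ ?_
    simp only [oscillatingGlue, slope_def_field, eval_mul, eval_X, ne_eq, OfNat.ofNat_ne_zero,
      not_false_eq_true, zero_pow, expNegInvGlue.zero, zero_mul, sub_zero]
    ring
  · have hinv := hasDerivAt_inv hx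
    have hglue : HasDerivAt expNegInvGlue (((x ^ 2)⁻¹) ^ 2 * expNegInvGlue (x ^ 2)) (x ^ 2) := by
      simpa using expNegInvGlue.hasDerivAt_polynomial_eval_inv_mul 1 (x ^ 2)
    have hglue' := HasDerivAt.comp (h := fun x : ℝ ↦ x ^ 2) x hglue (hasDerivAt_pow 2 x)
    have hp := (p.hasDerivAt x⁻¹).comp x hinv
    have hq := (q.hasDerivAt x⁻¹).comp x hinv
    have hcos := (hinv.pow 2).cos
    have hsin := (hinv.pow 2).sin
    refine (hglue'.mul ((hp.mul hcos).add (hq.mul hsin))).congr_deriv ?_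
    simp only [oscillatingGlue, eval_mul, eval_sub, eval_add, eval_pow, eval_X, eval_ofNat,
      Function.comp_apply, Pi.mul_apply, Pi.add_apply, Pi.pow_apply, Nat.cast_ofNat,
      Nat.add_one_sub_one, pow_one]
    field_simp
    ring

theorem contDiff_oscillatingGlue (p q : ℝ[X]) {n : ℕ∞} :
    ContDiff ℝ n (oscillatingGlue p q) := by
  refine contDiff_all_iff_nat.2 (fun m ↦ ?_) n
  have hdiff (p q : ℝ[X]) : Differentiable ℝ (oscillatingGlue p q) := fun x ↦
    (hasDerivAt_oscillatingGlue p q x).differentiableAt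
  induction m generalizing p q with
  | zero => exact contDiff_zero.2 (hdiff p q).continuous
  | succ m ihm =>
    rw [show ((m + 1 : ℕ) : WithTop ℕ∞) = m + 1 from rfl]
    refine contDiff_succ_iff_deriv.2 ⟨hdiff p q, by simp, ?_⟩
    rw [funext fun x ↦ (hasDerivAt_oscillatingGlue p q x).deriv]
    exact ihm _ _

end Smoothness

section ZeroSet

open Filter Topology

theorem cos_eq_zero_iff_exists_nat {t : ℝ} (ht : 0 < t) :
    Real.cos t = 0 ↔ ∃ k : ℕ, t = π / 2 + k * π := by
  rw [Real.cos_eq_zero_iff]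
  constructor
  · rintro ⟨k, hk⟩
    have hk0 : 0 ≤ k := by
      by_contra! hneg
      have : (k : ℝ) ≤ -1 := by exact_mod_cast Int.le_sub_one_of_lt hneg
      nlinarith [Real.pi_pos]
    lift k to ℕ using hk0
    refine ⟨k, hk.trans ?_⟩
    push_cast
    ring
  · rintro ⟨k, hk⟩
    refine ⟨k, hk.trans ?_⟩
    push_cast
    ring

theorem eventually_cos_inv_sq_ne_zero {y : ℝ} (hy : y ≠ 0) :
    ∀ᶠ x in 𝓝[≠] y, Real.cos (x⁻¹ ^ 2) ≠ 0 := by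
  have h : HasDerivAt (fun x : ℝ ↦ Real.cos (x⁻¹ ^ 2))
      (-Real.sin (y⁻¹ ^ 2) * (2 * y⁻¹ * -(y ^ 2)⁻¹)) y := by
    simpa using ((hasDerivAt_inv hy).pow 2).cos
  by_cases hsin : Real.sin (y⁻¹ ^ 2) = 0
  · have hcos : Real.cos (y⁻¹ ^ 2) ≠ 0 := fun hcos ↦ by
      have hone := Real.sin_sq_add_cos_sq (y⁻¹ ^ 2)
      rw [hsin, hcos] at hone
      norm_num at hone
    exact (h.continuousAt.eventually_ne hcos).filter_mono nhdsWithin_le_nhds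
  · exact h.eventually_ne (mul_ne_zero (neg_ne_zero.2 hsin) (by simp [hy]))

theorem tendsto_inv_sqrt_pi_div_two_add_nat_mul_pi :
    Tendsto (fun k : ℕ ↦ (√(π / 2 + k * π))⁻¹) atTop (𝓝 0) := by
  refine tendsto_inv_atTop_zero.comp (Real.tendsto_sqrt_atTop.comp ?_)
  exact tendsto_atTop_add_const_left _ _
    (tendsto_natCast_atTop_atTop.atTop_mul_const Real.pi_pos)

theorem sq_mul_eq_one_iff {x t : ℝ} (ht : 0 < t) :
    x ^ 2 * t = 1 ↔ x = (√t)⁻¹ ∨ x = -(√t)⁻¹ := by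
  rw [← sq_eq_sq_iff_eq_or_eq_neg, inv_pow, Real.sq_sqrt ht.le, ← one_div, eq_div_iff ht.ne']

end ZeroSet

/-- The function `f(x) = exp(−1/x²)·cos(1/x²)` (extended by `f(0) = 0`) is
`C^∞` on `ℝ`; for `x ≠ 0`, `f(x) = 0` iff `x²(π/2 + kπ) = 1` for some `k ∈ ℕ`; its zero set
is `{0} ∪ {±(π/2 + kπ)^{−1/2} : k ∈ ℕ}`, an infinite set whose only accumulation point
is `0`. -/
theorem zero_set_of_oscillating_function
    (f : ℝ → ℝ) (hf0 : f 0 = 0)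
    (hf : ∀ x : ℝ, x ≠ 0 → f x = Real.exp (-(1 / x ^ 2)) * Real.cos (1 / x ^ 2)) :
    ContDiff ℝ (⊤ : ℕ∞) f ∧
    (∀ x : ℝ, x ≠ 0 → (f x = 0 ↔ ∃ k : ℕ, x ^ 2 * (π / 2 + k * π) = 1)) ∧
    {x : ℝ | f x = 0} =
      {0} ∪ (⋃ k : ℕ, {(Real.sqrt (π / 2 + k * π))⁻¹, -(Real.sqrt (π / 2 + k * π))⁻¹}) ∧
    {x : ℝ | f x = 0}.Infinite ∧
    (∀ y : ℝ, AccPt y (Filter.principal {x : ℝ | f x = 0}) ↔ y = 0) := by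
  have hpos (k : ℕ) : 0 < π / 2 + k * π := by positivity
  have hsmooth : f = oscillatingGlue 1 0 := by
    funext x
    rcases eq_or_ne x 0 with rfl | hx
    · simp [hf0, oscillatingGlue]
    · have hx2 : ¬ x ^ 2 ≤ 0 := not_le.2 (by positivity)
      rw [hf x hx]
      simp [oscillatingGlue, expNegInvGlue, hx2]
  have hcos (x : ℝ) (hx : x ≠ 0) : f x = 0 ↔ Real.cos (x⁻¹ ^ 2) = 0 := by
    rw [hf x hx, mul_eq_zero_iff_left (Real.exp_ne_zero _), one_div, inv_pow]
  have hzero (x : ℝ) (hx : x ≠ 0) : f x = 0 ↔ ∃ k : ℕ, x ^ 2 * (π / 2 + k * π) = 1 := by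
    rw [hcos x hx, cos_eq_zero_iff_exists_nat (by positivity)]
    refine exists_congr fun k ↦ ?_
    rw [inv_pow, inv_eq_iff_eq_inv, ← one_div, eq_div_iff (hpos k).ne']
  have hset : {x : ℝ | f x = 0} =
      {0} ∪ (⋃ k : ℕ, {(√(π / 2 + k * π))⁻¹, -(√(π / 2 + k * π))⁻¹}) := by
    ext x
    simp only [Set.mem_ofPred_eq, Set.singleton_union, Set.mem_insert_iff, Set.mem_iUnion,
      Set.mem_singleton_iff, ← sq_mul_eq_one_iff (hpos _)]
    rcases eq_or_ne x 0 with rfl | hx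
    · simp [hf0]
    · simp [hx, hzero x hx]
  have hacc : AccPt (0 : ℝ) (Filter.principal {x : ℝ | f x = 0}) := by
    rw [accPt_iff_frequently]
    refine tendsto_inv_sqrt_pi_div_two_add_nat_mul_pi.frequently
      (Filter.Frequently.of_forall fun k ↦ ?_)
    have hne : (√(π / 2 + k * π))⁻¹ ≠ 0 := inv_ne_zero (Real.sqrt_pos.2 (hpos k)).ne'
    exact ⟨hne, (hzero _ hne).2 ⟨k, (sq_mul_eq_one_iff (hpos k)).2 (.inl rfl)⟩⟩
  refine ⟨hsmooth ▸ contDiff_oscillatingGlue 1 0, hzero, hset, .of_accPt hacc, fun y ↦ ⟨fun hy ↦ ?_, ?_⟩⟩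
  · by_contra hy0
    rw [accPt_iff_frequently_nhdsNE] at hy
    refine hy ?_
    filter_upwards [eventually_cos_inv_sq_ne_zero hy0,
      (eventually_ne_nhds hy0).filter_mono nhdsWithin_le_nhds] with x hx hx0
    exact fun h ↦ hx ((hcos x hx0).1 h)
  · rintro rfl
    exact hacc
end

section
/- For every ε > 0 there exist a positive integer m, a C^∞ function Q : ℝ → ℝ which is 2π-periodic with Q(x) > 0 and |Q(x) − 1| < ε for all x, and a C^∞ function Φ : ℝ² → ℝ which is 2π-periodic in each variable, such that ∂²Φ/∂x² + ∂²Φ/∂y² + m²·Q(x)·Φ = 0 on ℝ², and the open set {(x,y) ∈ (−π,π) × (−π,π) | Φ(x,y) > 1} has infinitely many connected components. (Hence on the torus T² = (ℝ/2πℤ)² with the Liouville metric g_Q = Q(x)(dx²+dy²), arbitrarily close to the flat metric, there is a Laplace eigenfunction Φ whose super-level set {Φ > 1} has infinitely many connected components, so the Extended Courant property fails for (T², g_Q).) -/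
open Real Set

/-- An open set of reals can be `{h > 0}` for a smooth nonnegative periodic `h` after pulling back
along `sin`; `h` then has a bounded second derivative. -/
lemma exists_periodic_contDiff_pos_iff_sin_mem {S : Set ℝ} (hS : IsOpen S) :
    ∃ h : ℝ → ℝ, ContDiff ℝ (⊤ : ℕ∞) h ∧ Function.Periodic h (2 * π) ∧ (∀ x, 0 ≤ h x) ∧
      (∀ x, 0 < h x ↔ sin x ∈ S) ∧ ContDiff ℝ (⊤ : ℕ∞) (deriv (deriv h)) ∧
      Function.Periodic (deriv (deriv h)) (2 * π) ∧ ∃ C, ∀ x, |deriv (deriv h) x| ≤ C := by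
  obtain ⟨f, hsupp, hf, hrange⟩ := hS.exists_contDiff_support_eq (n := ⊤)
  have hnonneg (t) : 0 ≤ f t := (hrange (mem_range_self t)).1
  have hsmooth : ContDiff ℝ (⊤ : ℕ∞) (fun x => f (sin x)) := hf.comp contDiff_sin
  have hper : Function.Periodic (fun x => f (sin x)) (2 * π) := fun x => by simp
  have periodic_deriv {g : ℝ → ℝ} (hg : Function.Periodic g (2 * π)) :
      Function.Periodic (deriv g) (2 * π) := fun x => by
    rw [← deriv_comp_add_const, funext hg]
  have hsmooth' : ContDiff ℝ (⊤ : ℕ∞) (deriv (deriv fun x => f (sin x))) :=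
    (contDiff_infty_iff_deriv.1 (contDiff_infty_iff_deriv.1 hsmooth).2).2
  have hper' := periodic_deriv (periodic_deriv hper)
  refine ⟨_, hsmooth, hper, fun x => hnonneg _, fun x => ?_, hsmooth', hper', ?_⟩
  · rw [← hsupp, Function.mem_support, (hnonneg _).lt_iff_ne']
  · obtain ⟨C, hC⟩ := (hper'.compact_of_continuous two_pi_pos.ne' hsmooth'.continuous).isBounded
      |>.exists_norm_le
    exact ⟨C, fun x => hC _ (mem_range_self x)⟩

/-- The complement of `{0} ∪ {1 / (k + 1) | k ∈ ℕ}`. -/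
def harmonicGaps : Set ℝ := (insert 0 (range fun k : ℕ => 1 / ((k : ℝ) + 1)))ᶜ

lemma isOpen_harmonicGaps : IsOpen harmonicGaps :=
  (tendsto_one_div_add_atTop_nhds_zero_nat (𝕜 := ℝ)).isCompact_insert_range.isClosed.isOpen_compl

lemma one_div_add_three_halves_mem_harmonicGaps (n : ℕ) :
    1 / ((n : ℝ) + 3 / 2) ∈ harmonicGaps := by
  rintro (h | ⟨k, h⟩)
  · have : 0 < 1 / ((n : ℝ) + 3 / 2) := by positivity
    exact this.ne' h
  · have : (2 * n + 3 : ℝ) = 2 * k + 2 := by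
      simp only [one_div, inv_inj] at h
      linarith
    norm_cast at this
    omega

/-- A preconnected subset of `harmonicGaps` meets `{1 / (n + 3 / 2)}` at most once. -/
lemma IsPreconnected.eq_of_one_div_add_three_halves_mem {s : Set ℝ} (hs : IsPreconnected s)
    (hsub : s ⊆ harmonicGaps) {n m : ℕ} (hn : 1 / ((n : ℝ) + 3 / 2) ∈ s)
    (hm : 1 / ((m : ℝ) + 3 / 2) ∈ s) : n = m := by
  wlog hlt : n < m generalizing n m
  · by_contra hne
    exact hne (this hm hn (by omega)).symm
  have hle : (n : ℝ) + 1 ≤ m := by exact_mod_cast hlt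
  refine absurd (Or.inr ⟨n + 1, rfl⟩) (hsub (hs.ordConnected.out hm hn ⟨?_, ?_⟩)) <;>
  · push_cast
    exact one_div_le_one_div_of_le (by positivity) (by linarith)

/-- A planar set whose points `(x, y)` satisfy `sin x ∈ harmonicGaps`, and which contains all
`(x, 0)` with `|x| < π` and `sin x ∈ harmonicGaps`, has infinitely many components. -/
lemma infinite_connectedComponents_of_sin_mem_harmonicGaps {p : ℝ × ℝ → Prop}
    (hp : ∀ z, p z → sin z.1 ∈ harmonicGaps)
    (hp' : ∀ x ∈ Ioo (-π) π, sin x ∈ harmonicGaps → p (x, 0)) :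
    Infinite (ConnectedComponents {z // p z}) := by
  have hsin (n : ℕ) : sin (arcsin (1 / ((n : ℝ) + 3 / 2))) = 1 / ((n : ℝ) + 3 / 2) := by
    have h0 : 0 < 1 / ((n : ℝ) + 3 / 2) := by positivity
    refine sin_arcsin (by linarith) ?_
    rw [div_le_one (by positivity)]
    linarith [n.cast_nonneg (α := ℝ)]
  have hpt (n : ℕ) : p (arcsin (1 / ((n : ℝ) + 3 / 2)), 0) := by
    refine hp' _ ⟨?_, ?_⟩ ((hsin n).symm ▸ one_div_add_three_halves_mem_harmonicGaps n)
    · linarith [neg_pi_div_two_le_arcsin (1 / ((n : ℝ) + 3 / 2)), pi_pos]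
    · linarith [arcsin_le_pi_div_two (1 / ((n : ℝ) + 3 / 2)), pi_pos]
  refine Infinite.of_injective (fun n : ℕ => ConnectedComponents.mk ⟨_, hpt n⟩) fun n m hnm => ?_
  have hcomp := ConnectedComponents.coe_eq_coe'.1 hnm
  have hcont : Continuous fun z : {z // p z} => sin z.1.1 := by fun_prop
  refine (isPreconnected_connectedComponent.image _ hcont.continuousOn
    ).eq_of_one_div_add_three_halves_mem ?_ ⟨_, hcomp, hsin n⟩ ⟨_, mem_connectedComponent, hsin m⟩
  rintro _ ⟨z, -, rfl⟩
  exact hp _ z.2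

/-- On the torus `T² = (ℝ/2πℤ)²` there is a Liouville metric
`g_Q = Q(x)(dx²+dy²)`, arbitrarily close to the flat metric, and a Laplace eigenfunction
`Φ` (eigenvalue `m²`) whose super-level set `{Φ > 1}` has infinitely many connected
components; hence the Extended Courant property fails for `(T², g_Q)`. Everything is
phrased via `2π`-periodic functions on `ℝ` and `ℝ²`. -/
theorem torus_eigenfunction_superlevel_infinitely_many_components :
    ∀ ε : ℝ, 0 < ε →
    ∃ (m : ℕ) (Q : ℝ → ℝ) (Φ : ℝ → ℝ → ℝ),
      0 < m ∧
      ContDiff ℝ (⊤ : ℕ∞) Q ∧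
      (∀ x, Q (x + 2 * π) = Q x) ∧
      (∀ x, 0 < Q x ∧ |Q x - 1| < ε) ∧
      ContDiff ℝ (⊤ : ℕ∞) (fun p : ℝ × ℝ => Φ p.1 p.2) ∧
      (∀ x y, Φ (x + 2 * π) y = Φ x y ∧ Φ x (y + 2 * π) = Φ x y) ∧
      (∀ x y, deriv (deriv (fun t => Φ t y)) x + deriv (deriv (fun t => Φ x t)) y +
        (m : ℝ) ^ 2 * Q x * Φ x y = 0) ∧
      Infinite (ConnectedComponents
        {p : ℝ × ℝ // p.1 ∈ Set.Ioo (-π) π ∧ p.2 ∈ Set.Ioo (-π) π ∧ 1 < Φ p.1 p.2}) := by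
  intro ε hε
  obtain ⟨h, hsmooth, hper, hnonneg, hpos, hsmooth', hper', C, hC⟩ :=
    exists_periodic_contDiff_pos_iff_sin_mem isOpen_harmonicGaps
  have hC0 : 0 ≤ C := (abs_nonneg _).trans (hC 0)
  obtain ⟨δ, hδ, hδC⟩ : ∃ δ : ℝ, 0 < δ ∧ δ * C < min ε 1 := by
    have hmin : 0 < min ε 1 := lt_min hε one_pos
    refine ⟨min ε 1 / (C + 1), by positivity, ?_⟩
    rw [div_mul_eq_mul_div, div_lt_iff₀ (by positivity)]
    linarith
  have hF (x) : 1 ≤ 1 + δ * h x := by linarith [mul_nonneg hδ.le (hnonneg x)]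
  have hF0 (x) : 1 + δ * h x ≠ 0 := by linarith [hF x]
  have hbound (x) : |δ * deriv (deriv h) x / (1 + δ * h x)| < min ε 1 := by
    refine lt_of_le_of_lt ?_ hδC
    rw [abs_div, abs_mul, abs_of_pos hδ, abs_of_pos (one_pos.trans_le (hF x))]
    exact (div_le_self (by positivity) (hF x)).trans (mul_le_mul_of_nonneg_left (hC x) hδ.le)
  refine ⟨1, fun x => 1 - δ * deriv (deriv h) x / (1 + δ * h x),
    fun x y => (1 + δ * h x) * cos y, one_pos, ?_, fun x => ?_, fun x => ⟨?_, ?_⟩, ?_,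
    fun x y => ⟨?_, ?_⟩, fun x y => ?_, ?_⟩
  · exact contDiff_const.sub ((contDiff_const.mul hsmooth').div
      (contDiff_const.add (contDiff_const.mul hsmooth)) hF0)
  · simp only [hper x, hper' x]
  · linarith [(abs_lt.1 ((hbound x).trans_le (min_le_right _ _))).2]
  · rw [sub_sub_cancel_left, abs_neg]
    exact (hbound x).trans_le (min_le_left _ _)
  · exact (contDiff_const.add (contDiff_const.mul (hsmooth.comp contDiff_fst))).mul
      (contDiff_cos.comp contDiff_snd)
  · simp only [hper x]
  · simp only [cos_add_two_pi]
  · have hxx : deriv (deriv fun t => (1 + δ * h t) * cos y) x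
        = δ * deriv (deriv h) x * cos y := by
      simp [deriv_mul_const_field']
    have hyy : deriv (deriv fun t => (1 + δ * h x) * cos t) y = -((1 + δ * h x) * cos y) := by
      simp [deriv_const_mul_field']
    rw [hxx, hyy]
    field_simp [hF0 x]
    push_cast
    ring
  · refine infinite_connectedComponents_of_sin_mem_harmonicGaps ?_ ?_
    · rintro ⟨x, y⟩ ⟨-, -, hxy⟩
      rw [← hpos]
      by_contra! hle
      have : h x = 0 := hle.antisymm (hnonneg x)
      simp only [this, mul_zero, add_zero, one_mul] at hxy
      exact hxy.not_ge (cos_le_one y)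
    · intro x hx hmem
      refine ⟨hx, ⟨neg_neg_of_pos pi_pos, pi_pos⟩, ?_⟩
      simpa using mul_pos hδ ((hpos x).2 hmem)
end
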